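/- arXiv:1507.06900 — 2 statements merged into one kernel-verified Lean document; each statement's English description precedes it below -/
import Mathlib

section
/- Let p, q ∈ ℝ^m be probability distributions with p↓ ≠ q↓. Then there exist k ∈ ℕ₀ and a k-partite probability distribution r_{1,…,k} with marginals r_1,…,r_k such that p ⊗ (r_1 ⊗ … ⊗ r_k) ≻ q ⊗ r_{1,…,k} if and only if rank(p) ≤ rank(q) and H(p) < H(q). Moreover, when these conditions hold, such a distribution exists already with k = 3. -/
open scoped BigOperators

/-- `p` is a probability distribution on the finite type `ι`. -/
def IsProbDist {ι : Type*} [Fintype ι] (p : ι → ℝ) : Prop :=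
  (∀ i, 0 ≤ p i) ∧ ∑ i, p i = 1

/-- `p` is a probability distribution with strictly positive entries. -/
def IsPosProbDist {ι : Type*} [Fintype ι] (p : ι → ℝ) : Prop :=
  (∀ i, 0 < p i) ∧ ∑ i, p i = 1

/-- `p` majorizes `q`: for every `k`, the sum of the `k` largest entries of `p` is at least
the sum of the `k` largest entries of `q`.  For nonnegative vectors this is equivalent to:
for every set `A` of indices of `q` there is a set `B` of indices of `p` with `|B| ≤ |A|`
whose `p`-sum dominates the `q`-sum over `A`. -/
def Majorizes {ι κ : Type*} [Fintype ι] [Fintype κ] (p : ι → ℝ) (q : κ → ℝ) : Prop :=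
  ∀ A : Finset κ, ∃ B : Finset ι, B.card ≤ A.card ∧ ∑ j ∈ A, q j ≤ ∑ i ∈ B, p i

/-- Kronecker (tensor) product of two vectors. -/
def kron {ι κ : Type*} (p : ι → ℝ) (q : κ → ℝ) : ι × κ → ℝ :=
  fun x => p x.1 * q x.2

/-- Shannon entropy (natural logarithm; note `Real.log 0 = 0`, so `0 log 0 = 0`). -/
noncomputable def shannonEntropy {ι : Type*} [Fintype ι] (p : ι → ℝ) : ℝ :=
  -∑ i, p i * Real.log (p i)

open Classical in
/-- The number of nonzero entries of `p`. -/
noncomputable def distRank {ι : Type*} [Fintype ι] (p : ι → ℝ) : ℕ :=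
  (Finset.univ.filter fun i => p i ≠ 0).card

/-- Marginal of a `k`-partite distribution on its `i`-th factor. -/
noncomputable def marginal {k : ℕ} {d : Fin k → ℕ} (r : (∀ i, Fin (d i)) → ℝ) (i : Fin k) :
    Fin (d i) → ℝ :=
  fun b => ∑ y : ∀ j, Fin (d j), if y i = b then r y else 0

open Classical in
/-- Rényi entropy of order `α` (with `H₁` being the Shannon entropy). -/
noncomputable def renyi {ι : Type*} [Fintype ι] (α : ℝ) (p : ι → ℝ) : ℝ :=
  if α = 1 then shannonEntropy p
  else (Real.sign α / (1 - α)) * Real.log (∑ i, p i ^ α)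

/-- Min-entropy `H_∞(p) = -log (max_i p_i)`. -/
noncomputable def renyiInf {ι : Type*} [Fintype ι] (p : ι → ℝ) : ℝ :=
  -Real.log (⨆ i, p i)

/-- Burg entropy `H_Burg(p) = (1/m) ∑ log p_i`. -/
noncomputable def burg {ι : Type*} [Fintype ι] (p : ι → ℝ) : ℝ :=
  (1 / (Fintype.card ι : ℝ)) * ∑ i, Real.log (p i)

open Classical in
/-- Rényi entropy as an extended real: it is `-∞` for `α < 0` when `p` has a zero entry. -/
noncomputable def renyiE {ι : Type*} [Fintype ι] (α : ℝ) (p : ι → ℝ) : EReal :=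
  if α < 0 ∧ ∃ i, p i = 0 then ⊥ else (renyi α p : EReal)

open Classical in
/-- Burg entropy as an extended real: it is `-∞` when `p` has a zero entry. -/
noncomputable def burgE {ι : Type*} [Fintype ι] (p : ι → ℝ) : EReal :=
  if ∃ i, p i = 0 then ⊥ else (burg p : EReal)

/-- `p` trumps `q`: there is a catalyst distribution `r` with `p ⊗ r ≻ q ⊗ r`. -/
def Trumps {ι κ : Type*} [Fintype ι] [Fintype κ] (p : ι → ℝ) (q : κ → ℝ) : Prop :=
  ∃ (n : ℕ) (r : Fin n → ℝ), IsProbDist r ∧ Majorizes (kron p r) (kron q r)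

/-- The bipartite extension `q_{AB}` of `q` with parameters `a i ∈ [0, q i]` and `n`:
the `m × (n+1)` matrix whose first column is `(q i - a i)` and whose remaining `n`
columns all equal `(a i / n)`. -/
noncomputable def qAB {m : ℕ} (q a : Fin m → ℝ) (n : ℕ) : Fin m × Fin (n + 1) → ℝ :=
  fun x => if x.2 = 0 then q x.1 - a x.1 else a x.1 / n

/-- The `B`-marginal `(1 - a, a/n, …, a/n)` of `qAB`, where `a = ∑ i, a i`. -/
noncomputable def qBext {m : ℕ} (a : Fin m → ℝ) (n : ℕ) : Fin (n + 1) → ℝ :=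
  fun j => if j = 0 then 1 - ∑ i, a i else (∑ i, a i) / n

/-- Symmetry of an entropy-like functional on positive distributions. -/
def SymmetricS (S : ∀ n : ℕ, (Fin n → ℝ) → ℝ) : Prop :=
  ∀ (n : ℕ) (p : Fin n → ℝ), IsPosProbDist p →
    ∀ σ : Equiv.Perm (Fin n), S n (p ∘ σ) = S n p

/-- Additivity: `S(p ⊗ q) = S(p) + S(q)`. -/
def AdditiveS (S : ∀ n : ℕ, (Fin n → ℝ) → ℝ) : Prop :=
  ∀ (m n : ℕ) (p : Fin m → ℝ) (q : Fin n → ℝ), IsPosProbDist p → IsPosProbDist q →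
    S (m * n) (fun x => kron p q (finProdFinEquiv.symm x)) = S m p + S n q

/-- Subadditivity: `S(p_{AB}) ≤ S(p_A ⊗ p_B)` for bipartite distributions. -/
def SubadditiveS (S : ∀ n : ℕ, (Fin n → ℝ) → ℝ) : Prop :=
  ∀ (m n : ℕ) (P : Fin m × Fin n → ℝ), IsPosProbDist P →
    S (m * n) (fun x => P (finProdFinEquiv.symm x)) ≤
      S (m * n) (fun x =>
        kron (fun i => ∑ j, P (i, j)) (fun j => ∑ i, P (i, j)) (finProdFinEquiv.symm x))

/-- Continuity of `S` on each simplex of positive distributions. -/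
def ContinuousS (S : ∀ n : ℕ, (Fin n → ℝ) → ℝ) : Prop :=
  ∀ n : ℕ, ContinuousOn (S n) {p : Fin n → ℝ | IsPosProbDist p}


theorem maj_of_inj {ι ι' κ : Type*} [Fintype ι] [Fintype ι'] [Fintype κ] {p : ι → ℝ} {q : κ → ℝ}
    (e : ι' → ι) (he : Function.Injective e) (h : Majorizes (p ∘ e) q) : Majorizes p q := by
  intro A
  obtain ⟨B, hB, hs⟩ := h A
  refine ⟨B.map ⟨e, he⟩, by simpa using hB, ?_⟩
  simpa using hs

theorem maj_ext {ι κ κ' : Type*} [Fintype ι] [Fintype κ] [Fintype κ'] {p : ι → ℝ} {q : κ → ℝ}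
    (e : κ' → κ) (he : Function.Injective e) (h0 : ∀ k, k ∉ Set.range e → q k = 0)
    (h : Majorizes p (q ∘ e)) : Majorizes p q := by
  classical
  intro A
  obtain ⟨B, hB, hs⟩ := h (A.preimage e he.injOn)
  refine ⟨B, hB.trans ?_, ?_⟩
  · rw [← Finset.card_image_of_injective _ he]
    apply Finset.card_le_card
    intro x hx
    simp only [Finset.mem_image, Finset.mem_preimage] at hx
    obtain ⟨a, ha, rfl⟩ := hx
    exact ha
  · refine le_trans (le_of_eq ?_) hs
    symm
    exact Finset.sum_preimage e A he.injOn q (fun x _ hx => h0 x hx)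

theorem maj_slice {ι κ σ : Type*} [Fintype ι] [Fintype κ] [Fintype σ] {f : ι × σ → ℝ}
    {g : κ × σ → ℝ} (h : ∀ s, Majorizes (fun i => f (i, s)) (fun k => g (k, s))) :
    Majorizes f g := by
  classical
  intro A
  choose B hB hs using fun s => h s (Finset.univ.filter fun k => (k, s) ∈ A)
  refine ⟨Finset.univ.filter fun x => x.1 ∈ B x.2, ?_, ?_⟩
  · have e1 : (Finset.univ.filter fun x : ι × σ => x.1 ∈ B x.2).card = ∑ s, (B s).card := by
      rw [Finset.card_filter, Fintype.sum_prod_type_right]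
      refine Finset.sum_congr rfl fun s _ => ?_
      simp
    have e2 : A.card = ∑ s, (Finset.univ.filter fun k => (k, s) ∈ A).card := by
      have : A.card = ∑ x : κ × σ, if x ∈ A then 1 else 0 := by simp
      rw [this, Fintype.sum_prod_type_right]
      refine Finset.sum_congr rfl fun s _ => ?_
      rw [Finset.card_filter]
    rw [e1, e2]
    exact Finset.sum_le_sum fun s _ => hB s
  · have e1 : ∑ j ∈ A, g j = ∑ s, ∑ k ∈ Finset.univ.filter (fun k => (k, s) ∈ A), g (k, s) := by
      have : ∑ j ∈ A, g j = ∑ x : κ × σ, if x ∈ A then g x else 0 := by simp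
      rw [this, Fintype.sum_prod_type_right]
      refine Finset.sum_congr rfl fun s _ => ?_
      rw [Finset.sum_filter]
    have e2 : ∑ i ∈ Finset.univ.filter (fun x : ι × σ => x.1 ∈ B x.2), f i
        = ∑ s, ∑ i ∈ B s, f (i, s) := by
      rw [Finset.sum_filter, Fintype.sum_prod_type_right]
      refine Finset.sum_congr rfl fun s _ => ?_
      simp
    rw [e1, e2]
    exact Finset.sum_le_sum fun s _ => hs s

theorem maj_refl {ι : Type*} [Fintype ι] (f : ι → ℝ) : Majorizes f f :=
  fun A => ⟨A, le_rfl, le_rfl⟩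

theorem maj_smul {ι κ : Type*} [Fintype ι] [Fintype κ] {f : ι → ℝ} {g : κ → ℝ}
    (h : Majorizes f g) (c : ℝ) (hc : 0 ≤ c) :
    Majorizes (fun i => f i * c) (fun k => g k * c) := by
  intro A
  obtain ⟨B, hB, hs⟩ := h A
  refine ⟨B, hB, ?_⟩
  rw [← Finset.sum_mul, ← Finset.sum_mul]
  exact mul_le_mul_of_nonneg_right hs hc

theorem maj_kron {ι κ σ : Type*} [Fintype ι] [Fintype κ] [Fintype σ] {f : ι → ℝ} {g : κ → ℝ}
    (h : Majorizes f g) (s : σ → ℝ) (hs : ∀ i, 0 ≤ s i) :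
    Majorizes (kron f s) (kron g s) :=
  maj_slice fun i => maj_smul h (s i) (hs i)

theorem maj_convex {ι κ τ : Type*} [Fintype ι] [Fintype κ] [Fintype τ] {f : ι → ℝ}
    {g : τ → κ → ℝ} (w : τ → ℝ) (hw : ∀ t, 0 ≤ w t) (hw1 : ∑ t, w t = 1)
    (h : ∀ t, Majorizes f (g t)) : Majorizes f (fun k => ∑ t, w t * g t k) := by
  intro A
  choose B hB hs using fun t => h t A
  have hne : (Finset.univ : Finset τ).Nonempty := by
    by_contra hcon
    rw [Finset.not_nonempty_iff_eq_empty] at hcon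
    rw [hcon] at hw1
    simp at hw1
  obtain ⟨t0, -, ht0⟩ := Finset.exists_max_image Finset.univ (fun t => ∑ i ∈ B t, f i) hne
  refine ⟨B t0, hB t0, ?_⟩
  rw [Finset.sum_comm]
  calc ∑ t, ∑ k ∈ A, w t * g t k = ∑ t, w t * ∑ k ∈ A, g t k := by
        simp [Finset.mul_sum]
    _ ≤ ∑ t, w t * ∑ i ∈ B t0, f i := by
        refine Finset.sum_le_sum fun t _ => mul_le_mul_of_nonneg_left ?_ (hw t)
        exact (hs t).trans (ht0 t (Finset.mem_univ _))
    _ = ∑ i ∈ B t0, f i := by rw [← Finset.sum_mul, hw1, one_mul]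

/-- Hybrid distribution: first `j` coordinates as in `Q`, the rest i.i.d. `p`. -/
noncomputable def hyb {S : Type*} [Fintype S] [DecidableEq S] {N : ℕ} (p : S → ℝ)
    (Q : (Fin N → S) → ℝ) (j : ℕ) (x : Fin N → S) : ℝ :=
  ∑ z, Q z * ∏ i : Fin N, if (i : ℕ) < j then (if z i = x i then 1 else 0) else p (x i)

theorem sum_prod_fun {S : Type*} [Fintype S] {N : ℕ} (f : Fin N → S → ℝ) :
    ∑ x : Fin N → S, ∏ i, f i (x i) = ∏ i, ∑ s, f i s := by
  classical
  rw [Finset.prod_univ_sum]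
  simp

section
variable {S : Type*} [Fintype S] [DecidableEq S] {n : ℕ} (p : S → ℝ)
    (Q : (Fin (n + 1) → S) → ℝ)

theorem hyb_zero (hQ1 : ∑ x, Q x = 1) (x) : hyb p Q 0 x = ∏ i, p (x i) := by
  simp [hyb, ← Finset.sum_mul, hQ1]

theorem hyb_last (x) : hyb p Q (n + 1) x = Q x := by
  unfold hyb
  have : ∀ z : Fin (n + 1) → S, (∏ i : Fin (n + 1), if (i : ℕ) < n + 1 then
      (if z i = x i then (1 : ℝ) else 0) else p (x i)) = if z = x then 1 else 0 := by
    intro z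
    rw [Finset.prod_congr rfl (fun i _ => if_pos i.2)]
    by_cases h : z = x
    · simp [h]
    · rw [if_neg h]
      obtain ⟨i, hi⟩ := Function.ne_iff.mp h
      exact Finset.prod_eq_zero (Finset.mem_univ i) (if_neg hi)
  simp only [this]
  simp

theorem hyb_step (j : Fin (n + 1)) (a : S) (y : Fin n → S) :
    p a * ∑ a', hyb p Q (j + 1) (Fin.insertNth (α := fun _ => S) j a' y)
      = hyb p Q j (Fin.insertNth (α := fun _ => S) j a y) := by
  unfold hyb
  rw [Finset.sum_comm, Finset.mul_sum]
  refine Finset.sum_congr rfl fun z _ => ?_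
  rw [← Finset.mul_sum]
  have h1 : ∀ a' : S, (∏ i : Fin (n + 1), if (i : ℕ) < j + 1 then
      (if z i = (Fin.insertNth (α := fun _ => S) j a' y) i then (1 : ℝ) else 0)
        else p ((Fin.insertNth (α := fun _ => S) j a' y) i))
      = (if z j = a' then 1 else 0) * ∏ k : Fin n, if ((j.succAbove k : Fin (n+1)) : ℕ) < j then
      (if z (j.succAbove k) = y k then (1 : ℝ) else 0) else p (y k) := by
    intro a'
    rw [Fin.prod_univ_succAbove _ j]
    congr 1
    · simp
    · refine Finset.prod_congr rfl fun k _ => ?_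
      have hne : ((j.succAbove k : Fin (n+1)) : ℕ) ≠ j := by
        intro h
        exact Fin.succAbove_ne j k (Fin.ext h)
      have : ((j.succAbove k : Fin (n+1)) : ℕ) < j + 1 ↔ ((j.succAbove k : Fin (n+1)) : ℕ) < j := by
        omega
      simp only [this, Fin.insertNth_apply_succAbove]
  simp only [h1]
  rw [← Finset.sum_mul]
  rw [Fin.prod_univ_succAbove _ j]
  simp
  ring

theorem hyb_marg (hp1 : ∑ a, p a = 1) (j : Fin (n + 1)) (a : S) :
    ∑ y : Fin n → S, hyb p Q (j + 1) (Fin.insertNth (α := fun _ => S) j a y)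
      = ∑ z, Q z * (if z j = a then 1 else 0) := by
  unfold hyb
  rw [Finset.sum_comm]
  refine Finset.sum_congr rfl fun z _ => ?_
  rw [← Finset.mul_sum]
  congr 1
  have h1 : ∀ y : Fin n → S, (∏ i : Fin (n + 1), if (i : ℕ) < j + 1 then
      (if z i = (Fin.insertNth (α := fun _ => S) j a y) i then (1 : ℝ) else 0)
        else p ((Fin.insertNth (α := fun _ => S) j a y) i))
      = (if z j = a then 1 else 0) * ∏ k : Fin n, (fun k s =>
        if ((j.succAbove k : Fin (n+1)) : ℕ) < j + 1 then
      (if z (j.succAbove k) = s then (1 : ℝ) else 0) else p s) k (y k) := by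
    intro a'
    rw [Fin.prod_univ_succAbove _ j]
    congr 1
    · simp
    · refine Finset.prod_congr rfl fun k _ => ?_
      simp only [Fin.insertNth_apply_succAbove]
  simp only [h1]
  rw [← Finset.mul_sum]
  rw [sum_prod_fun (fun (k : Fin n) s =>
        if ((j.succAbove k : Fin (n+1)) : ℕ) < j + 1 then
      (if z (j.succAbove k) = s then (1 : ℝ) else 0) else p s)]
  rw [Finset.prod_eq_one, mul_one]
  intro k _
  split_ifs <;> simp [hp1]

theorem hyb_nonneg (hp : ∀ a, 0 ≤ p a) (hQ : ∀ x, 0 ≤ Q x) (j x) : 0 ≤ hyb p Q j x := by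
  refine Finset.sum_nonneg fun z _ => mul_nonneg (hQ z) (Finset.prod_nonneg fun i _ => ?_)
  split_ifs <;> simp [hp]

/-- multi-copy to single-copy with correlated catalyst -/
theorem single_copy (q : S → ℝ) (hp : IsProbDist p) (hQ : IsProbDist Q)
    (hmaj : Majorizes (fun x : Fin (n + 1) → S => ∏ i, p (x i)) Q)
    (hq : ∀ a, ∑ x, Q x * (∑ j, if x j = a then (1 : ℝ) else 0) = (n + 1) * q a) :
    ∃ (R : S × (Fin (n + 1) × (Fin n → S)) → ℝ), (∀ x, 0 ≤ R x) ∧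
      (∀ a, ∑ b, R (a, b) = q a) ∧ Majorizes (kron p (fun b => ∑ a, R (a, b))) R := by
  have hn : (0 : ℝ) < n + 1 := by positivity
  refine ⟨fun x => hyb p Q (x.2.1 + 1) (Fin.insertNth (α := fun _ => S) x.2.1 x.1 x.2.2)
    * (1 / ((n : ℝ) + 1)), ?_, ?_, ?_⟩
  · intro x
    exact mul_nonneg (hyb_nonneg p Q hp.1 hQ.1 _ _) (by positivity)
  · intro a
    rw [Fintype.sum_prod_type]
    simp only [← Finset.sum_mul, hyb_marg p Q hp.2]
    rw [Finset.sum_comm]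
    simp only [← Finset.mul_sum]
    rw [hq]
    field_simp
  · -- reindex
    let E : S × (Fin (n + 1) × (Fin n → S)) ≃ (Fin (n + 1) → S) × Fin (n + 1) :=
      { toFun := fun x => (Fin.insertNth (α := fun _ => S) x.2.1 x.1 x.2.2, x.2.1)
        invFun := fun x => (x.1 x.2, (x.2, fun k => x.1 (x.2.succAbove k)))
        left_inv := by
          rintro ⟨a, j, y⟩
          simp
        right_inv := by
          rintro ⟨x, j⟩
          simp only [Prod.mk.injEq, and_true]
          exact Fin.insertNth_self_removeNth j x }
    let f : (Fin (n + 1) → S) × Fin (n + 1) → ℝ := fun x => hyb p Q x.2 x.1 * (1 / ((n : ℝ) + 1))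
    let g : (Fin (n + 1) → S) × Fin (n + 1) → ℝ :=
      fun x => hyb p Q (x.2 + 1) x.1 * (1 / ((n : ℝ) + 1))
    have hfg : Majorizes (f ∘ Prod.map id (finRotate (n + 1))) g := by
      apply maj_slice
      intro j
      refine maj_smul (f := fun i => hyb p Q (finRotate (n + 1) j) i)
        (g := fun i => hyb p Q (j + 1) i) ?_ _ (by positivity)
      rcases eq_or_ne j (Fin.last n) with rfl | hj
      · simp only [finRotate_last, Fin.val_zero, Fin.val_last, hyb_last]
        simpa only [hyb_zero p Q hQ.2] using hmaj
      · rw [coe_finRotate_of_ne_last hj]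
        exact maj_refl _
    have hfg2 : Majorizes f g :=
      maj_of_inj _ (Function.injective_id.prodMap (finRotate (n + 1)).injective) hfg
    have h3 : Majorizes (f ∘ E) (g ∘ E) := by
      apply maj_of_inj E.symm E.symm.injective
      apply maj_ext E.symm E.symm.injective
      · intro k hk
        exact absurd (E.symm.surjective k) hk
      · simpa [Function.comp_assoc] using hfg2
    have h4 : f ∘ E = kron p (fun b => ∑ a, g (E (a, b))) := by
      funext x
      obtain ⟨a, j, y⟩ := x
      simp only [kron, f, g, E, Function.comp, Equiv.coe_fn_mk, ← Finset.sum_mul, ← mul_assoc]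
      rw [hyb_step]
    rw [h4] at h3
    exact h3
end

section
variable {S : Type*} [Fintype S] [DecidableEq S]

theorem iid_pair {n : ℕ} (w h : S → ℝ) (hw : ∑ a, w a = 1) (h0 : ∑ a, w a * h a = 0)
    (i j : Fin n) :
    ∑ x : Fin n → S, (∏ k, w (x k)) * (h (x i) * h (x j))
      = if i = j then ∑ a, w a * h a ^ 2 else 0 := by
  have h1 : ∀ x : Fin n → S, (∏ k, w (x k)) * (h (x i) * h (x j)) =
      ∏ k, (fun (k : Fin n) s => w s * ((if k = i then h s else 1) * (if k = j then h s else 1)))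
        k (x k) := by
    intro x
    simp only [Finset.prod_mul_distrib]
    simp
  simp only [h1]
  rw [sum_prod_fun (fun (k : Fin n) s =>
    w s * ((if k = i then h s else 1) * (if k = j then h s else 1)))]
  split_ifs with hij
  · subst hij
    rw [Finset.prod_eq_single i]
    · simp [sq]
    · intro b _ hb
      simp [hb, hw]
    · simp
  · apply Finset.prod_eq_zero (Finset.mem_univ i)
    simp [hij, h0]

theorem iid_var {n : ℕ} (w h : S → ℝ) (hw : ∑ a, w a = 1) (h0 : ∑ a, w a * h a = 0) :
    ∑ x : Fin n → S, (∏ k, w (x k)) * (∑ i, h (x i)) ^ 2 = n * ∑ a, w a * h a ^ 2 := by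
  have h1 : ∀ x : Fin n → S, (∏ k, w (x k)) * (∑ i, h (x i)) ^ 2 =
      ∑ i, ∑ j, (∏ k, w (x k)) * (h (x i) * h (x j)) := by
    intro x
    rw [sq, Finset.sum_mul_sum]
    simp only [Finset.mul_sum]
  simp only [h1]
  rw [Finset.sum_comm]
  have h2 : ∀ i : Fin n, ∑ x : Fin n → S, ∑ j, (∏ k, w (x k)) * (h (x i) * h (x j))
      = ∑ a, w a * h a ^ 2 := by
    intro i
    rw [Finset.sum_comm]
    simp only [iid_pair w h hw h0]
    simp
  simp [h2]

theorem iid_sum {n : ℕ} (w : S → ℝ) (hw : ∑ a, w a = 1) :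
    ∑ x : Fin n → S, ∏ k, w (x k) = 1 := by
  rw [sum_prod_fun (fun _ s => w s)]
  simp [hw]

theorem cheb {κ : Type*} [Fintype κ] (w : S → ℝ) (hw : IsProbDist w) (g : κ → S → ℝ)
    (η δ : ℝ) (hη : 0 < η) (hδ : 0 < δ) :
    ∃ N : ℕ, ∀ n ≥ N, ∑ x ∈ Finset.univ.filter (fun x : Fin n → S =>
      ∃ k, n * η ≤ |∑ i, g k (x i) - n * ∑ a, w a * g k a|), ∏ i, w (x i) ≤ δ := by
  set h : κ → S → ℝ := fun k s => g k s - ∑ a, w a * g k a with hh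
  have h0 : ∀ k, ∑ a, w a * h k a = 0 := by
    intro k
    simp only [hh, mul_sub, Finset.sum_sub_distrib, ← Finset.sum_mul, hw.2]
    simp
  set V : ℝ := ∑ k, ∑ a, w a * h k a ^ 2 with hV
  obtain ⟨N, hN⟩ := exists_nat_gt (V / (η ^ 2 * δ))
  refine ⟨max N 1, fun n hn => ?_⟩
  have hn1 : 1 ≤ n := (le_max_right _ _).trans hn
  have hnN : (N : ℝ) ≤ n := by exact_mod_cast (le_max_left _ _).trans hn
  have hnpos : (0 : ℝ) < n := by exact_mod_cast hn1
  have hP : ∀ x : Fin n → S, 0 ≤ ∏ i, w (x i) := fun x => Finset.prod_nonneg fun i _ => hw.1 _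
  have key : (n * η) ^ 2 * ∑ x ∈ Finset.univ.filter (fun x : Fin n → S =>
      ∃ k, n * η ≤ |∑ i, g k (x i) - n * ∑ a, w a * g k a|), ∏ i, w (x i) ≤ n * V := by
    calc _ = ∑ x ∈ Finset.univ.filter (fun x : Fin n → S =>
      ∃ k, n * η ≤ |∑ i, g k (x i) - n * ∑ a, w a * g k a|), (∏ i, w (x i)) * (n * η) ^ 2 := by
          rw [mul_comm, Finset.sum_mul]
      _ ≤ ∑ x ∈ Finset.univ.filter (fun x : Fin n → S =>
      ∃ k, n * η ≤ |∑ i, g k (x i) - n * ∑ a, w a * g k a|),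
          (∏ i, w (x i)) * ∑ k, (∑ i, h k (x i)) ^ 2 := by
          refine Finset.sum_le_sum fun x hx => mul_le_mul_of_nonneg_left ?_ (hP x)
          obtain ⟨k, hk⟩ := (Finset.mem_filter.mp hx).2
          have e : ∑ i, h k (x i) = ∑ i, g k (x i) - n * ∑ a, w a * g k a := by
            simp [hh, Finset.sum_sub_distrib]
          refine le_trans ?_ (Finset.single_le_sum (f := fun k => (∑ i, h k (x i)) ^ 2)
            (fun k _ => sq_nonneg _) (Finset.mem_univ k))
          simp only [e]
          rw [← sq_abs (∑ i, g k (x i) - n * ∑ a, w a * g k a)]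
          exact pow_le_pow_left₀ (by positivity) hk 2
      _ ≤ ∑ x : Fin n → S, (∏ i, w (x i)) * ∑ k, (∑ i, h k (x i)) ^ 2 := by
          refine Finset.sum_le_sum_of_subset_of_nonneg (Finset.subset_univ _) fun x _ _ => ?_
          exact mul_nonneg (hP x) (Finset.sum_nonneg fun k _ => sq_nonneg _)
      _ = n * V := by
          simp only [Finset.mul_sum]
          rw [Finset.sum_comm]
          simp only [iid_var w _ hw.2 (h0 _)]
          rw [hV, Finset.mul_sum]
  have h5 : V ≤ n * (η ^ 2 * δ) := by
    have := hN.le.trans hnN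
    rwa [div_le_iff₀ (by positivity)] at this
  have h6 : (n * η) ^ 2 * ∑ x ∈ Finset.univ.filter (fun x : Fin n → S =>
      ∃ k, n * η ≤ |∑ i, g k (x i) - n * ∑ a, w a * g k a|), ∏ i, w (x i) ≤ (n * η) ^ 2 * δ := by
    refine key.trans ?_
    calc (n : ℝ) * V ≤ n * (n * (η ^ 2 * δ)) := by gcongr
      _ = _ := by ring
  exact le_of_mul_le_mul_left h6 (by positivity)

theorem entropy_mean (w : S → ℝ) : ∑ a, w a * Real.log (w a) = - shannonEntropy w := by
  simp [shannonEntropy]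

theorem core (p q : S → ℝ) (hp : IsProbDist p) (hq : IsProbDist q)
    (hH : shannonEntropy p < shannonEntropy q) (ε : ℝ) (hε : 0 < ε) :
    ∃ N : ℕ, ∀ n ≥ N, ∃ π : Equiv.Perm (Fin n → S), ∀ a,
      |∑ x, (∏ i, p (π x i)) * (∑ j, if x j = a then (1 : ℝ) else 0) - n * q a| ≤ n * ε := by
  set η := (shannonEntropy q - shannonEntropy p) / 3 with hη
  have hη0 : 0 < η := by rw [hη]; linarith
  obtain ⟨N1, hN1⟩ := cheb (κ := Unit) p hp (fun _ s => Real.log (p s)) η (ε / 2) hη0 (by linarith)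
  obtain ⟨N2, hN2⟩ := cheb (κ := Option S) q hq
    (fun k s => k.elim (Real.log (q s)) (fun a => if s = a then 1 else 0)) (min η (ε / 2)) (1 / 2)
    (lt_min hη0 (by linarith)) (by norm_num)
  obtain ⟨N3, hN3⟩ := exists_nat_gt (Real.log 2 / η)
  refine ⟨max N1 (max N2 N3), fun n hn => ?_⟩
  have hn1 : N1 ≤ n := (le_max_left _ _).trans hn
  have hn2 : N2 ≤ n := (le_max_left _ _).trans ((le_max_right _ _).trans hn)
  have hn3 : N3 ≤ n := (le_max_right _ _).trans ((le_max_right _ _).trans hn)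
  have g1 := hN1 n hn1
  have g2 := hN2 n hn2
  have g3 : (2 : ℝ) ≤ Real.exp (n * η) := by
    have : Real.log 2 ≤ n * η := by
      have h := hN3.le.trans (show (N3 : ℝ) ≤ n by exact_mod_cast hn3)
      rwa [div_le_iff₀ hη0] at h
    calc (2 : ℝ) = Real.exp (Real.log 2) := (Real.exp_log (by norm_num)).symm
      _ ≤ _ := Real.exp_le_exp.mpr this
  clear hN1 hN2 hN3
  have hP : ∀ x : Fin n → S, 0 ≤ ∏ i, p (x i) := fun x => Finset.prod_nonneg fun i _ => hp.1 _
  have hW : ∀ x : Fin n → S, 0 ≤ ∏ i, q (x i) := fun x => Finset.prod_nonneg fun i _ => hq.1 _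
  have hP1 := iid_sum (n := n) p hp.2
  have hW1 := iid_sum (n := n) q hq.2
  simp only [entropy_mean, exists_const] at g1
  set B : Finset (Fin n → S) := Finset.univ.filter (fun x =>
    ¬ (n * η ≤ |∑ i, Real.log (p (x i)) - n * -shannonEntropy p|) ∧ ∏ i, p (x i) ≠ 0) with hB
  set T : Finset (Fin n → S) := Finset.univ.filter (fun x => ¬ (∃ k : Option S,
    n * (min η (ε / 2)) ≤ |∑ i, k.elim (Real.log (q (x i))) (fun a => if x i = a then 1 else 0)
      - n * ∑ b, q b * k.elim (Real.log (q b)) (fun a => if b = a then 1 else 0)|)) with hT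
  -- mass of complement of B
  have hBc : ∑ x ∈ Bᶜ, ∏ i, p (x i) ≤ ε / 2 := by
    refine le_trans ?_ g1
    rw [Finset.sum_filter, ← Finset.sum_filter_add_sum_filter_not Bᶜ (fun x => ∏ i, p (x i) ≠ 0)]
    have : ∑ x ∈ Bᶜ with ¬ (∏ i, p (x i) ≠ 0), ∏ i, p (x i) = 0 := by
      refine Finset.sum_eq_zero fun x hx => ?_
      simpa using (Finset.mem_filter.mp hx).2
    rw [this, add_zero, ← Finset.sum_filter]
    refine Finset.sum_le_sum_of_subset_of_nonneg ?_ fun x _ _ => hP x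
    intro x hx
    simp only [hB, Finset.mem_filter, Finset.mem_compl, Finset.mem_univ, true_and] at hx ⊢
    by_contra hcon
    exact hx.1 ⟨hcon, hx.2⟩
  have hTm : 1 / 2 ≤ ∑ x ∈ T, ∏ i, q (x i) := by
    have := Finset.sum_filter_add_sum_filter_not Finset.univ (fun x : Fin n → S => (∃ k : Option S,
    n * (min η (ε / 2)) ≤ |∑ i, k.elim (Real.log (q (x i))) (fun a => if x i = a then 1 else 0)
      - n * ∑ b, q b * k.elim (Real.log (q b)) (fun a => if b = a then 1 else 0)|))
      (fun x => ∏ i, q (x i))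
    rw [hW1, ← hT] at this
    linarith
  have hexp : ∀ (w : S → ℝ) (hw : ∀ a, 0 ≤ w a) (x : Fin n → S), ∏ i, w (x i) ≠ 0 →
      ∏ i, w (x i) = Real.exp (∑ i, Real.log (w (x i))) := by
    intro w hw x hx
    rw [Real.exp_sum]
    refine Finset.prod_congr rfl fun i _ => ?_
    have : w (x i) ≠ 0 := (Finset.prod_ne_zero_iff.mp hx) i (Finset.mem_univ i)
    rw [Real.exp_log (lt_of_le_of_ne (hw _) this.symm)]
  have hBcard : (B.card : ℝ) ≤ Real.exp (n * (shannonEntropy p + η)) := by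
    have : ∑ x ∈ B, Real.exp (- (n * (shannonEntropy p + η))) ≤ 1 := by
      rw [← hP1]
      refine le_trans (Finset.sum_le_sum (g := fun x => ∏ i, p (x i)) fun x hx => ?_)
        (Finset.sum_le_sum_of_subset_of_nonneg (Finset.subset_univ _) fun x _ _ => hP x)
      obtain ⟨h1, h2⟩ := (Finset.mem_filter.mp hx).2
      rw [hexp p hp.1 x h2, Real.exp_le_exp]
      have := (abs_lt.mp (not_le.mp h1)).1
      linarith
    rw [Finset.sum_const, nsmul_eq_mul, Real.exp_neg] at this
    rwa [← div_eq_mul_inv, div_le_one (Real.exp_pos _)] at this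
  have hTcard : Real.exp (n * (shannonEntropy q - η)) / 2 ≤ T.card := by
    have : 1 / 2 ≤ ∑ x ∈ T, Real.exp (- (n * (shannonEntropy q - η))) := by
      refine hTm.trans (Finset.sum_le_sum fun x hx => ?_)
      have h1 := (Finset.mem_filter.mp hx).2
      push Not at h1
      have h2 := h1 none
      simp only [Option.elim_none, entropy_mean] at h2
      by_cases h3 : ∏ i, q (x i) = 0
      · rw [h3]; positivity
      · rw [hexp q hq.1 x h3, Real.exp_le_exp]
        have h4 := (abs_lt.mp h2).2
        have h5 : n * min η (ε / 2) ≤ n * η := by gcongr; exact min_le_left _ _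
        linarith
    rw [Finset.sum_const, nsmul_eq_mul, Real.exp_neg, ← div_eq_mul_inv,
      le_div_iff₀ (Real.exp_pos _)] at this
    linarith
  have hcard : B.card ≤ T.card := by
    have : (B.card : ℝ) ≤ T.card := by
      refine hBcard.trans (le_trans ?_ hTcard)
      have : n * (shannonEntropy q - η) = n * (shannonEntropy p + η) + n * η := by
        rw [hη]; ring
      rw [this, Real.exp_add]
      have := Real.exp_pos (n * (shannonEntropy p + η))
      nlinarith
    exact_mod_cast this
  obtain ⟨T', hT', hT'c⟩ := Finset.exists_subset_card_eq hcard
  obtain ⟨e⟩ : Nonempty ({x // x ∈ T'} ≃ {x // x ∈ B}) :=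
    ⟨Finset.equivOfCardEq hT'c⟩
  set π : Equiv.Perm (Fin n → S) := e.extendSubtype with hπ
  refine ⟨π, fun a => ?_⟩
  have hmem : ∀ x, x ∉ T' → π x ∈ Bᶜ := by
    intro x hx
    rw [Finset.mem_compl]
    exact e.extendSubtype_not_mem x hx
  have hPπ : ∑ x, ∏ i, p (π x i) = 1 := by
    rw [Equiv.sum_comp π (fun x => ∏ i, p (x i)), hP1]
  have hcnt0 : ∀ x : Fin n → S, 0 ≤ ∑ j, (if x j = a then (1 : ℝ) else 0) := fun x =>
    Finset.sum_nonneg fun j _ => by split_ifs <;> norm_num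
  have hcnt1 : ∀ x : Fin n → S, ∑ j, (if x j = a then (1 : ℝ) else 0) ≤ n := fun x => by
    calc _ ≤ ∑ j : Fin n, (1 : ℝ) := Finset.sum_le_sum fun j _ => by split_ifs <;> norm_num
      _ = n := by simp
  have hqa : q a ≤ 1 := by
    rw [← hq.2]; exact Finset.single_le_sum (fun b _ => hq.1 b) (Finset.mem_univ a)
  have hpt : ∀ x : Fin n → S, (∏ i, p (π x i)) * |∑ j, (if x j = a then (1 : ℝ) else 0) - n * q a|
      ≤ (∏ i, p (π x i)) * (n * (ε / 2)) + (if x ∈ T' then 0 else (∏ i, p (π x i)) * n) := by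
    intro x
    split_ifs with hx
    · rw [add_zero]
      refine mul_le_mul_of_nonneg_left ?_ (hP _)
      have h1 := (Finset.mem_filter.mp (hT' hx)).2
      push Not at h1
      have h2 := h1 (some a)
      simp only [Option.elim_some] at h2
      simp only [mul_ite, mul_one, mul_zero, Finset.sum_ite_eq', Finset.mem_univ, if_true] at h2
      refine h2.le.trans ?_
      gcongr
      exact min_le_right _ _
    · have : |∑ j, (if x j = a then (1 : ℝ) else 0) - n * q a| ≤ n := by
        have h1 := hcnt0 x
        have h2 := hcnt1 x
        have h3 : 0 ≤ n * q a := mul_nonneg (by positivity) (hq.1 a)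
        have h4 : n * q a ≤ n := by
          have : (0 : ℝ) ≤ n := by positivity
          nlinarith
        rw [abs_le]; constructor <;> linarith
      have h6 := mul_le_mul_of_nonneg_left this (hP (π x))
      have h7 : 0 ≤ (∏ i, p (π x i)) * (n * (ε / 2)) := mul_nonneg (hP _) (by positivity)
      linarith
  calc |∑ x, (∏ i, p (π x i)) * (∑ j, if x j = a then (1 : ℝ) else 0) - n * q a|
      = |∑ x, (∏ i, p (π x i)) * (∑ j, (if x j = a then (1 : ℝ) else 0) - n * q a)| := by
        congr 1
        simp only [mul_sub, Finset.sum_sub_distrib, ← Finset.sum_mul, hPπ, one_mul]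
    _ ≤ ∑ x, (∏ i, p (π x i)) * |∑ j, (if x j = a then (1 : ℝ) else 0) - n * q a| := by
        refine (Finset.abs_sum_le_sum_abs _ _).trans (le_of_eq ?_)
        refine Finset.sum_congr rfl fun x _ => ?_
        rw [abs_mul, abs_of_nonneg (hP _)]
    _ ≤ ∑ x, ((∏ i, p (π x i)) * (n * (ε / 2)) +
          (if x ∈ T' then 0 else (∏ i, p (π x i)) * n)) := Finset.sum_le_sum fun x _ => hpt x
    _ = n * (ε / 2) + ∑ x, (if x ∈ T' then 0 else (∏ i, p (π x i)) * n) := by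
        rw [Finset.sum_add_distrib, ← Finset.sum_mul, hPπ, one_mul]
    _ ≤ n * (ε / 2) + ∑ x, (if π x ∈ Bᶜ then (∏ i, p (π x i)) * n else 0) := by
        gcongr with x
        split_ifs with h1 h2 h2
        · exact mul_nonneg (hP _) (by positivity)
        · exact le_rfl
        · exact le_rfl
        · exact absurd (hmem x h1) h2
    _ = n * (ε / 2) + n * ∑ x ∈ Bᶜ, ∏ i, p (x i) := by
        rw [Equiv.sum_comp π (fun x => if x ∈ Bᶜ then (∏ i, p (x i)) * (n : ℝ) else 0),
          Finset.mul_sum]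
        congr 1
        rw [Finset.sum_ite_mem, Finset.univ_inter]
        exact Finset.sum_congr rfl fun x _ => mul_comm _ _
    _ ≤ n * (ε / 2) + n * (ε / 2) := by gcongr
    _ = n * ε := by ring
end

theorem exact_marg {S : Type*} [Fintype S] [DecidableEq S] (p q : S → ℝ) (hp : IsProbDist p)
    (hq : IsProbDist q) (hqpos : ∀ a, 0 < q a) (hH : shannonEntropy p < shannonEntropy q) :
    ∃ (n : ℕ) (Q : (Fin (n + 1) → S) → ℝ), IsProbDist Q ∧
      Majorizes (fun x : Fin (n + 1) → S => ∏ i, p (x i)) Q ∧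
      ∀ a, ∑ x, Q x * (∑ j, if x j = a then (1 : ℝ) else 0) = (n + 1) * q a := by
  have hne : (Finset.univ : Finset S).Nonempty := by
    by_contra hcon
    rw [Finset.not_nonempty_iff_eq_empty] at hcon
    have := hq.2
    rw [hcon] at this
    simp at this
  set v : ℝ → S → S → ℝ := fun t a b => (1 - t) * q b + t * (if b = a then 1 else 0) with hv
  have hcont : ∀ a, Continuous fun t => shannonEntropy (v t a) := by
    intro a
    unfold shannonEntropy
    refine (continuous_finsetSum _ fun b _ => ?_).neg
    exact Real.continuous_mul_log.comp (f := fun t => v t a b) (by fun_prop)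
  have hev : ∀ᶠ t in nhdsWithin (0 : ℝ) (Set.Ioi 0),
      (∀ a, shannonEntropy p < shannonEntropy (v t a)) ∧ t < 1 ∧ 0 < t := by
    refine Filter.Eventually.and ?_ (Filter.Eventually.and ?_ self_mem_nhdsWithin)
    · rw [Filter.eventually_all]
      intro a
      refine nhdsWithin_le_nhds ?_
      refine (hcont a).continuousAt.eventually (lt_mem_nhds ?_)
      have : v 0 a = q := by funext b; simp [hv]
      simp only [this]; exact hH
    · exact nhdsWithin_le_nhds (gt_mem_nhds one_pos)
  obtain ⟨t, ht, ht1, ht0⟩ := hev.exists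
  obtain ⟨a0, -, ha0⟩ := Finset.exists_min_image Finset.univ q hne
  have hvp : ∀ a, IsProbDist (v t a) := by
    intro a
    constructor
    · intro b
      simp only [hv]
      have := hq.1 b
      have h1 : 0 ≤ (1 - t) * q b := mul_nonneg (by linarith) this
      split_ifs <;> linarith
    · simp only [hv, Finset.sum_add_distrib, ← Finset.mul_sum, hq.2]
      simp
  set ε := t * q a0 with hε
  have hε0 : 0 < ε := mul_pos ht0 (hqpos a0)
  choose N hN using fun a => core p (v t a) hp (hvp a) (ht a) ε hε0
  set n := ∑ a, N a with hn
  choose π hπ using fun a => hN a (n + 1)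
    ((Finset.single_le_sum (f := N) (fun _ _ => Nat.zero_le _) (Finset.mem_univ a)).trans
      (Nat.le_succ _))
  have hn0 : (0 : ℝ) < n + 1 := by positivity
  have hP : ∀ x : Fin (n + 1) → S, 0 ≤ ∏ i, p (x i) :=
    fun x => Finset.prod_nonneg fun i _ => hp.1 _
  have hPπ : ∀ a, ∑ x, ∏ i, p (π a x i) = 1 := by
    intro a
    rw [Equiv.sum_comp (π a) (fun x => ∏ i, p (x i)), iid_sum p hp.2]
  set c : S → S → ℝ := fun a b =>
    (∑ x, (∏ i, p (π a x i)) * (∑ j, if x j = b then (1 : ℝ) else 0)) / (n + 1) with hc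
  have hc1 : ∀ a, ∑ b, c a b = 1 := by
    intro a
    simp only [hc]
    rw [← Finset.sum_div, Finset.sum_comm, div_eq_one_iff_eq hn0.ne']
    have : ∀ x : Fin (n + 1) → S, ∑ b, (∏ i, p (π a x i)) *
        (∑ j, if x j = b then (1 : ℝ) else 0) = (∏ i, p (π a x i)) * (n + 1) := by
      intro x
      rw [← Finset.mul_sum, Finset.sum_comm]
      simp
    simp only [this]
    rw [← Finset.sum_mul, hPπ, one_mul]
  have hcv : ∀ a b, c a b ≤ v t a b + ε := by
    intro a b
    have h1 := (abs_le.mp (hπ a b)).2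
    push_cast at h1
    simp only [hc]
    rw [div_le_iff₀ hn0]
    linarith
  -- q in the hull
  have hull : ∃ w ∈ stdSimplex ℝ S, (∑ a, w a • c a) = q := by
    by_contra hcon
    let L : (S → ℝ) →ₗ[ℝ] (S → ℝ) :=
      { toFun := fun w => ∑ a, w a • c a
        map_add' := by intro x y; simp [add_smul, Finset.sum_add_distrib]
        map_smul' := by intro r x; simp [Finset.smul_sum, smul_smul] }
    have hLc : Continuous L := L.continuous_of_finiteDimensional
    have hcl : IsClosed (L '' stdSimplex ℝ S) := ((isCompact_stdSimplex ℝ S).image hLc).isClosed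
    have hcx : Convex ℝ (L '' stdSimplex ℝ S) := (convex_stdSimplex ℝ S).linear_image L
    have hq' : q ∉ L '' stdSimplex ℝ S := by
      rintro ⟨w, hw, hwq⟩
      exact hcon ⟨w, hw, hwq⟩
    obtain ⟨f, u, hfu, hfb⟩ := geometric_hahn_banach_point_closed hcx hcl hq'
    set φ : S → ℝ := fun b => f (Pi.single b 1) with hφ
    have hf : ∀ x : S → ℝ, f x = ∑ b, x b * φ b := by
      intro x
      have := LinearMap.pi_apply_eq_sum_univ (f : (S → ℝ) →ₗ[ℝ] ℝ) x
      simp only [ContinuousLinearMap.coe_coe, smul_eq_mul] at this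
      rw [this]
      refine Finset.sum_congr rfl fun b _ => ?_
      congr 1
      simp only [hφ]
      congr 1
      funext k
      simp [Pi.single_apply, eq_comm]
    obtain ⟨a1, -, ha1⟩ := Finset.exists_min_image Finset.univ φ hne
    have hmem : c a1 ∈ L '' stdSimplex ℝ S := by
      refine ⟨Pi.single a1 1, single_mem_stdSimplex ℝ a1, ?_⟩
      change ∑ a, (Pi.single a1 1 : S → ℝ) a • c a = c a1
      rw [Finset.sum_eq_single a1]
      · simp
      · intro b _ hb; simp [hb]
      · simp
    have h1 : f q < f (c a1) := hfu.trans (hfb _ hmem)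
    have h2 : f (c a1) - f q = ∑ b, (φ b - φ a1) * (c a1 b - q b) := by
      rw [hf, hf]
      simp only [sub_mul, mul_sub, Finset.sum_sub_distrib, ← Finset.mul_sum, hc1, hq.2]
      simp only [mul_comm]
      ring
    have h3 : ∑ b, (φ b - φ a1) * (c a1 b - q b) ≤ 0 := by
      refine Finset.sum_nonpos fun b _ => ?_
      by_cases hb : b = a1
      · simp [hb]
      · have h4 := hcv a1 b
        simp only [hv, hb, if_false] at h4
        have h5 : ε ≤ t * q b := mul_le_mul_of_nonneg_left (ha0 b (Finset.mem_univ _)) ht0.le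
        have h6 := ha1 b (Finset.mem_univ _)
        refine mul_nonpos_of_nonneg_of_nonpos (by linarith) (by linarith)
    linarith
  obtain ⟨w, hw, hwq⟩ := hull
  refine ⟨n, fun x => ∑ a, w a * ∏ i, p (π a x i), ⟨?_, ?_⟩, ?_, ?_⟩
  · intro x
    exact Finset.sum_nonneg fun a _ => mul_nonneg (hw.1 a) (hP _)
  · rw [Finset.sum_comm]
    simp only [← Finset.mul_sum, hPπ, mul_one]
    exact hw.2
  · refine maj_convex w hw.1 hw.2 (fun a => ?_)
    refine maj_of_inj (π a) (π a).injective ?_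
    exact maj_refl _
  · intro b
    have h1 := congrFun hwq b
    simp only [Finset.sum_apply, Pi.smul_apply, smul_eq_mul, hc] at h1
    rw [← h1, Finset.mul_sum]
    simp only [Finset.sum_mul]
    rw [Finset.sum_comm]
    refine Finset.sum_congr rfl fun a _ => ?_
    rw [mul_div_assoc', mul_div_cancel₀ _ hn0.ne', Finset.mul_sum]
    exact Finset.sum_congr rfl fun x _ => mul_assoc _ _ _


/-- triples as dependent functions -/
def tripleEquiv (s t : ℕ) : (∀ i, Fin ((![s, t, 1] : Fin 3 → ℕ) i)) ≃ Fin s × Fin t where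
  toFun := fun y => (y 0, y 1)
  invFun := fun z => Fin.cons (α := fun i => Fin ((![s, t, 1] : Fin 3 → ℕ) i)) z.1
    (Fin.cons (α := fun i : Fin 2 => Fin ((![s, t, 1] : Fin 3 → ℕ) i.succ)) z.2
      (fun i : Fin 1 => ⟨0, by fin_cases i; exact Nat.one_pos⟩))
  left_inv := by
    intro y
    funext i
    fin_cases i
    · rfl
    · rfl
    · exact Subsingleton.elim (α := Fin 1) _ _
  right_inv := by
    rintro ⟨a, b⟩
    rfl

/-- from a correlated-catalyst transition to the `k = 3` form -/
theorem to_three {m s t : ℕ} (p q : Fin m → ℝ) (hq : IsProbDist q) (e : Fin s → Fin m)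
    (he : Function.Injective e) (hs : ∀ i, i ∉ Set.range e → q i = 0)
    (R : Fin s × Fin t → ℝ) (hR : ∀ x, 0 ≤ R x) (hRq : ∀ a, ∑ b, R (a, b) = q (e a))
    (hmaj : Majorizes (kron p (fun b => ∑ a, R (a, b))) R) :
    ∃ (d : Fin 3 → ℕ) (r : (∀ i, Fin (d i)) → ℝ), IsProbDist r ∧
        Majorizes (kron p (fun y : ∀ i, Fin (d i) => ∏ i, marginal r i (y i))) (kron q r) := by
  have hsum : ∑ a, q (e a) = 1 := by
    rw [← hq.2]
    exact Fintype.sum_of_injective e he _ _ hs (fun _ => rfl)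
  set r : (∀ i, Fin ((![s, t, 1] : Fin 3 → ℕ) i)) → ℝ := fun y => R (tripleEquiv s t y) with hr
  have hr1 : ∑ y, r y = 1 := by
    rw [← hsum, Equiv.sum_comp (tripleEquiv s t) R, Fintype.sum_prod_type]
    exact Finset.sum_congr rfl fun a _ => hRq a
  have m0 : ∀ a : Fin s, marginal r 0 a = q (e a) := by
    intro a
    have : marginal r 0 a = ∑ y, (fun z : Fin s × Fin t => if z.1 = a then R z else 0)
      (tripleEquiv s t y) := rfl
    refine this.trans ((Equiv.sum_comp (tripleEquiv s t)
      (fun z : Fin s × Fin t => if z.1 = a then R z else 0)).trans ?_)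
    rw [Fintype.sum_prod_type_right]
    simp [hRq]
  have m1 : ∀ b : Fin t, marginal r 1 b = ∑ a, R (a, b) := by
    intro b
    have : marginal r 1 b = ∑ y, (fun z : Fin s × Fin t => if z.2 = b then R z else 0)
      (tripleEquiv s t y) := rfl
    refine this.trans ((Equiv.sum_comp (tripleEquiv s t)
      (fun z : Fin s × Fin t => if z.2 = b then R z else 0)).trans ?_)
    rw [Fintype.sum_prod_type]
    simp
  have m2 : ∀ c : Fin 1, marginal r 2 c = 1 := by
    intro c
    rw [← hr1]
    unfold marginal
    refine Finset.sum_congr rfl fun y _ => if_pos ?_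
    exact Subsingleton.elim (α := Fin 1) _ _
  refine ⟨![s, t, 1], r, ⟨fun y => hR _, hr1⟩, ?_⟩
  have hprod : ∀ y : (∀ i, Fin ((![s, t, 1] : Fin 3 → ℕ) i)), ∏ i, marginal r i (y i)
      = q (e (tripleEquiv s t y).1) * ∑ a, R (a, (tripleEquiv s t y).2) := by
    intro y
    rw [Fin.prod_univ_three]
    refine Eq.trans (congrArg₂ (· * ·) (congrArg₂ (· * ·) (m0 _) (m1 _)) (m2 _)) ?_
    simp only [mul_one]
    rfl
  refine maj_of_inj (ι' := (Fin m × Fin t) × Fin s)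
    (fun z => (z.1.1, (tripleEquiv s t).symm (z.2, z.1.2))) ?_ ?_
  · rintro ⟨⟨i, b⟩, a⟩ ⟨⟨i', b'⟩, a'⟩ h
    simp only [Prod.mk.injEq, EmbeddingLike.apply_eq_iff_eq] at h ⊢
    tauto
  refine maj_ext (κ' := (Fin s × Fin t) × Fin s)
    (fun z => (e z.2, (tripleEquiv s t).symm z.1)) ?_ ?_ ?_
  · rintro ⟨z, a⟩ ⟨z', a'⟩ h
    simp only [Prod.mk.injEq, EmbeddingLike.apply_eq_iff_eq] at h ⊢
    exact ⟨h.2, he h.1⟩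
  · rintro ⟨i, y⟩ h
    simp only [kron]
    rw [hs i, zero_mul]
    rintro ⟨a, rfl⟩
    exact h ⟨(tripleEquiv s t y, a), by simp⟩
  have h1 := maj_kron hmaj (fun a => q (e a)) (fun a => hq.1 _)
  have e1 : kron (kron p fun b => ∑ a, R (a, b)) (fun a => q (e a)) =
      kron p (fun y => ∏ i, marginal r i (y i)) ∘
        fun z : (Fin m × Fin t) × Fin s => (z.1.1, (tripleEquiv s t).symm (z.2, z.1.2)) := by
    funext z
    simp only [kron, Function.comp]
    rw [hprod]
    simp only [Equiv.apply_symm_apply]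
    ring
  have e2 : kron R (fun a => q (e a)) = kron q r ∘
      fun z : (Fin s × Fin t) × Fin s => (e z.2, (tripleEquiv s t).symm z.1) := by
    funext z
    simp only [kron, Function.comp, hr, Equiv.apply_symm_apply]
    ring
  rw [← e1, ← e2]
  exact h1

theorem entropy_inj {ι κ : Type*} [Fintype ι] [Fintype κ] (p : ι → ℝ) (e : κ → ι)
    (he : Function.Injective e) (h : ∀ i, i ∉ Set.range e → p i = 0) :
    shannonEntropy (p ∘ e) = shannonEntropy p := by
  unfold shannonEntropy
  congr 1
  refine Fintype.sum_of_injective e he _ _ ?_ (fun _ => rfl)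
  intro i hi
  simp [h i hi]

theorem prob_inj {ι κ : Type*} [Fintype ι] [Fintype κ] (p : ι → ℝ) (hp : IsProbDist p) (e : κ → ι)
    (he : Function.Injective e) (h : ∀ i, i ∉ Set.range e → p i = 0) :
    IsProbDist (p ∘ e) := by
  refine ⟨fun i => hp.1 _, ?_⟩
  rw [← hp.2]
  exact Fintype.sum_of_injective e he _ _ h (fun _ => rfl)

theorem forward {m : ℕ} (p q : Fin m → ℝ) (hp : IsProbDist p) (hq : IsProbDist q)
    (hr : distRank p ≤ distRank q) (hH : shannonEntropy p < shannonEntropy q) :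
    ∃ (d : Fin 3 → ℕ) (r : (∀ i, Fin (d i)) → ℝ), IsProbDist r ∧
        Majorizes (kron p (fun y : ∀ i, Fin (d i) => ∏ i, marginal r i (y i))) (kron q r) := by
  classical
  set A : Finset (Fin m) := Finset.univ.filter fun i => q i ≠ 0 with hA
  have hAc : distRank q = A.card := by
    unfold distRank
    rw [hA]
  obtain ⟨B, hB1, hB2⟩ := Finset.exists_superset_card_eq (s := Finset.univ.filter fun i => p i ≠ 0)
    (n := A.card) (by rw [← hAc]; exact hr) (by simpa using A.card_le_univ)
  set s := A.card with hs
  let e : Fin s → Fin m := fun k => (A.equivFin.symm k).1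
  have he : Function.Injective e := Subtype.val_injective.comp A.equivFin.symm.injective
  let e' : Fin s → Fin m := fun k => ((B.equivFinOfCardEq hB2).symm k).1
  have he' : Function.Injective e' :=
    Subtype.val_injective.comp (B.equivFinOfCardEq hB2).symm.injective
  have h0 : ∀ i, i ∉ Set.range e → q i = 0 := by
    intro i hi
    by_contra hcon
    refine hi ⟨A.equivFin ⟨i, by simp [hA, hcon]⟩, by simp [e]⟩
  have h0' : ∀ i, i ∉ Set.range e' → p i = 0 := by
    intro i hi
    by_contra hcon
    refine hi ⟨B.equivFinOfCardEq hB2 ⟨i, hB1 (by simp [hcon])⟩, by simp [e']⟩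
  have hpos : ∀ a, 0 < (q ∘ e) a := by
    intro a
    have := (A.equivFin.symm a).2
    simp only [hA, Finset.mem_filter, Finset.mem_univ, true_and] at this
    exact lt_of_le_of_ne (hq.1 _) (Ne.symm this)
  have hp' := prob_inj p hp e' he' h0'
  obtain ⟨n, Q, hQ, hQmaj, hQq⟩ := exact_marg (p ∘ e') (q ∘ e) hp'
    (prob_inj q hq e he h0) hpos (by rw [entropy_inj p e' he' h0', entropy_inj q e he h0]; exact hH)
  obtain ⟨R, hR0, hRq, hRmaj⟩ := single_copy (p ∘ e') Q (q ∘ e) hp' hQ hQmaj hQq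
  let E := Fintype.equivFin (Fin (n + 1) × (Fin n → Fin s))
  refine to_three (t := Fintype.card (Fin (n + 1) × (Fin n → Fin s))) p q hq e he h0
    (fun x => R (x.1, E.symm x.2)) (fun x => hR0 _) ?_ ?_
  · intro a
    rw [Equiv.sum_comp E.symm (fun b => R (a, b))]
    exact hRq a
  · refine maj_of_inj (ι' := Fin s × (Fin (n + 1) × (Fin n → Fin s)))
      (Prod.map e' E) (he'.prodMap E.injective) ?_
    refine maj_ext (κ' := Fin s × (Fin (n + 1) × (Fin n → Fin s)))
      (Prod.map id E) (Function.injective_id.prodMap E.injective) ?_ ?_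
    · intro k hk
      exact absurd ((Function.surjective_id.prodMap E.surjective) k) hk
    · convert hRmaj using 1
      · funext z
        simp [kron]
      · funext z
        simp

theorem maj_excess {ι κ : Type*} [Fintype ι] [Fintype κ] {f : ι → ℝ} {g : κ → ℝ}
    (h : Majorizes f g) (t : ℝ) (ht : 0 ≤ t) :
    ∑ k, max (g k - t) 0 ≤ ∑ i, max (f i - t) 0 := by
  classical
  obtain ⟨B, hB, hs⟩ := h (Finset.univ.filter fun k => t < g k)
  have h1 : ∑ k, max (g k - t) 0 = ∑ k ∈ Finset.univ.filter (fun k => t < g k), (g k - t) := by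
    rw [Finset.sum_filter]
    refine Finset.sum_congr rfl fun k _ => ?_
    split_ifs with hk
    · exact max_eq_left (by linarith)
    · exact max_eq_right (by linarith)
  rw [h1]
  calc _ = ∑ k ∈ Finset.univ.filter (fun k => t < g k), g k -
        (Finset.univ.filter (fun k => t < g k)).card * t := by
        rw [Finset.sum_sub_distrib, Finset.sum_const, nsmul_eq_mul]
    _ ≤ ∑ i ∈ B, f i - B.card * t := by
        have : (B.card : ℝ) ≤ (Finset.univ.filter (fun k => t < g k)).card := by exact_mod_cast hB
        nlinarith
    _ = ∑ i ∈ B, (f i - t) := by rw [Finset.sum_sub_distrib, Finset.sum_const, nsmul_eq_mul]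
    _ ≤ ∑ i ∈ B, max (f i - t) 0 := Finset.sum_le_sum fun i _ => le_max_left _ _
    _ ≤ _ := Finset.sum_le_sum_of_subset_of_nonneg (Finset.subset_univ _)
        fun i _ _ => le_max_right _ _

theorem kern_cont (x : ℝ) (hx : 0 ≤ x) : Continuous fun t : ℝ => 1 - x / max t x := by
  rcases hx.eq_or_lt with rfl | hx
  · simp only [zero_div]; fun_prop
  · refine continuous_const.sub (continuous_const.div (by fun_prop) fun t => ?_)
    exact (lt_of_lt_of_le hx (le_max_right _ _)).ne'

theorem kern_int (x : ℝ) (hx : 0 ≤ x) (hx1 : x ≤ 1) :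
    ∫ t in (0 : ℝ)..1, (1 - x / max t x) = 1 - x + x * Real.log x := by
  rcases hx.eq_or_lt with rfl | hx
  · simp
  · have hc := kern_cont x hx.le
    rw [← intervalIntegral.integral_add_adjacent_intervals
      (hc.intervalIntegrable 0 x) (hc.intervalIntegrable x 1)]
    have h1 : ∫ t in (0 : ℝ)..x, (1 - x / max t x) = 0 := by
      rw [intervalIntegral.integral_congr (g := fun _ => (0 : ℝ))]
      · simp
      · intro t ht
        rw [Set.uIcc_of_le hx.le] at ht
        simp only [max_eq_right ht.2, div_self hx.ne', sub_self]
    have h2 : ∫ t in x..(1 : ℝ), (1 - x / max t x) = ∫ t in x..(1 : ℝ), (1 - x * t⁻¹) := by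
      refine intervalIntegral.integral_congr ?_
      intro t ht
      rw [Set.uIcc_of_le hx1] at ht
      simp only [max_eq_left ht.1, div_eq_mul_inv]
    have hi : IntervalIntegrable (fun t : ℝ => t⁻¹) MeasureTheory.volume x 1 := by
      refine intervalIntegral.intervalIntegrable_inv (fun t ht => ?_) continuousOn_id
      rw [Set.uIcc_of_le hx1] at ht
      exact (lt_of_lt_of_le hx ht.1).ne'
    rw [h1, h2, intervalIntegral.integral_sub (by simp) (hi.const_mul x),
      intervalIntegral.integral_const_mul, integral_inv_of_pos hx one_pos]
    simp [Real.log_inv]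

theorem kern_eq (x t : ℝ) (hx : 0 ≤ x) (ht : 0 < t) :
    1 - x / max t x = (max (x - t) 0 - (x - t)) / t := by
  rcases le_total t x with h | h
  · have : 0 < x := lt_of_lt_of_le ht h
    rw [max_eq_right h, max_eq_left (by linarith), div_self this.ne']; simp
  · rw [max_eq_left h, max_eq_right (by linarith)]
    field_simp
    ring

theorem prob_le_one {ι : Type*} [Fintype ι] {f : ι → ℝ} (hf : IsProbDist f) (i : ι) : f i ≤ 1 := by
  rw [← hf.2]; exact Finset.single_le_sum (fun b _ => hf.1 b) (Finset.mem_univ i)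

theorem schur {ι : Type*} [Fintype ι] {f g : ι → ℝ} (hf : IsProbDist f) (hg : IsProbDist g)
    (h : Majorizes f g) : shannonEntropy f ≤ shannonEntropy g ∧
      (shannonEntropy f = shannonEntropy g → ∀ t ∈ Set.Icc (0 : ℝ) 1,
        ∑ i, max (f i - t) 0 = ∑ i, max (g i - t) 0) := by
  set D : ℝ → ℝ := fun t => ∑ i, (1 - f i / max t (f i)) - ∑ i, (1 - g i / max t (g i)) with hD
  have hcont : Continuous D := (continuous_finsetSum _ fun i _ => kern_cont _ (hf.1 i)).sub
    (continuous_finsetSum _ fun i _ => kern_cont _ (hg.1 i))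
  have hI : ∀ f : ι → ℝ, IsProbDist f → ∫ t in (0 : ℝ)..1, ∑ i, (1 - f i / max t (f i))
      = Fintype.card ι - 1 - shannonEntropy f := by
    intro f hf
    rw [intervalIntegral.integral_finsetSum
      (fun i _ => (kern_cont _ (hf.1 i)).intervalIntegrable _ _)]
    rw [Finset.sum_congr rfl fun i _ => kern_int (f i) (hf.1 i) (prob_le_one hf i)]
    simp [Finset.sum_add_distrib, Finset.sum_sub_distrib, hf.2, shannonEntropy]
  have hint : ∫ t in (0 : ℝ)..1, D t = shannonEntropy g - shannonEntropy f := by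
    simp only [hD]
    rw [intervalIntegral.integral_sub, hI f hf, hI g hg]
    · ring
    · exact (continuous_finsetSum _ fun i _ => kern_cont _ (hf.1 i)).intervalIntegrable _ _
    · exact (continuous_finsetSum _ fun i _ => kern_cont _ (hg.1 i)).intervalIntegrable _ _
  have hDt : ∀ t, 0 < t → D t = (∑ i, max (f i - t) 0 - ∑ i, max (g i - t) 0) / t := by
    intro t ht
    simp only [hD]
    rw [Finset.sum_congr rfl fun i _ => kern_eq (f i) t (hf.1 i) ht,
      Finset.sum_congr rfl fun i _ => kern_eq (g i) t (hg.1 i) ht]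
    simp only [← Finset.sum_div, Finset.sum_sub_distrib, hf.2, hg.2]
    ring
  have hD0 : ∀ t, 0 < t → 0 ≤ D t := by
    intro t ht
    rw [hDt t ht]
    exact div_nonneg (sub_nonneg.mpr (maj_excess h t ht.le)) ht.le
  constructor
  · have : 0 ≤ ∫ t in (0 : ℝ)..1, D t := by
      rw [intervalIntegral.integral_of_le zero_le_one]
      exact MeasureTheory.setIntegral_nonneg measurableSet_Ioc fun x hx => hD0 x hx.1
    linarith
  · intro heq t ht
    rcases ht.1.eq_or_lt with rfl | ht0
    · simp only [sub_zero]
      rw [Finset.sum_congr rfl fun i _ => max_eq_left (hf.1 i),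
        Finset.sum_congr rfl fun i _ => max_eq_left (hg.1 i), hf.2, hg.2]
    · by_contra hcon
      have hlt : 0 < D t := by
        refine lt_of_le_of_ne (hD0 t ht0) fun h0 => hcon ?_
        rw [hDt t ht0] at h0
        rw [eq_comm, div_eq_zero_iff] at h0
        rcases h0 with h0 | h0 <;> linarith
      have := intervalIntegral.integral_pos (f := D) (a := 0) (b := 1) one_pos hcont.continuousOn
        (fun x hx => hD0 x hx.1) ⟨t, ht, hlt⟩
      linarith

theorem pow_int (x : ℝ) (hx : 0 ≤ x) (hx1 : x ≤ 1) (n : ℕ) :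
    ∫ t in (0 : ℝ)..1, t ^ n * max (x - t) 0 = x ^ (n + 2) * (1 / (n + 1) - 1 / (n + 2)) := by
  have hc : Continuous fun t : ℝ => t ^ n * max (x - t) 0 := by fun_prop
  rw [← intervalIntegral.integral_add_adjacent_intervals
      (hc.intervalIntegrable 0 x) (hc.intervalIntegrable x 1)]
  have h1 : ∫ t in x..(1 : ℝ), t ^ n * max (x - t) 0 = 0 := by
    rw [intervalIntegral.integral_congr (g := fun _ => (0 : ℝ))]
    · simp
    · intro t ht
      rw [Set.uIcc_of_le hx1] at ht
      simp only
      rw [max_eq_right (by linarith [ht.1]), mul_zero]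
  have h2 : ∫ t in (0 : ℝ)..x, t ^ n * max (x - t) 0 =
      ∫ t in (0 : ℝ)..x, (x * t ^ n - t ^ (n + 1)) := by
    refine intervalIntegral.integral_congr ?_
    intro t ht
    rw [Set.uIcc_of_le hx] at ht
    simp only
    rw [max_eq_left (by linarith [ht.2])]
    ring
  rw [h1, h2, intervalIntegral.integral_sub (by apply Continuous.intervalIntegrable; fun_prop)
    (by apply Continuous.intervalIntegrable; fun_prop), intervalIntegral.integral_const_mul,
    integral_pow, integral_pow]
  push_cast
  simp
  field_simp
  ring

theorem pow_sums {ι : Type*} [Fintype ι] {f g : ι → ℝ} (hf : IsProbDist f) (hg : IsProbDist g)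
    (h : ∀ t ∈ Set.Icc (0 : ℝ) 1, ∑ i, max (f i - t) 0 = ∑ i, max (g i - t) 0) (n : ℕ) :
    ∑ i, f i ^ n = ∑ i, g i ^ n := by
  rcases n with _ | _ | n
  · simp
  · simp [hf.2, hg.2]
  · have hI : ∀ f : ι → ℝ, IsProbDist f → ∫ t in (0 : ℝ)..1, t ^ n * ∑ i, max (f i - t) 0
      = (∑ i, f i ^ (n + 2)) * (1 / (n + 1) - 1 / (n + 2)) := by
      intro f hf
      simp only [Finset.mul_sum]
      rw [intervalIntegral.integral_finsetSum
        (fun i _ => by apply Continuous.intervalIntegrable; fun_prop)]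
      rw [Finset.sum_congr rfl fun i _ => pow_int (f i) (hf.1 i) (prob_le_one hf i) n]
      rw [Finset.sum_mul]
    have h1 : ∫ t in (0 : ℝ)..1, t ^ n * ∑ i, max (f i - t) 0 =
        ∫ t in (0 : ℝ)..1, t ^ n * ∑ i, max (g i - t) 0 := by
      refine intervalIntegral.integral_congr fun t ht => ?_
      rw [Set.uIcc_of_le zero_le_one] at ht
      simp only [h t ht]
    rw [hI f hf, hI g hg] at h1
    refine mul_right_cancel₀ ?_ h1
    have : (1 : ℝ) / (n + 1) - 1 / (n + 2) = 1 / ((n + 1) * (n + 2)) := by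
      field_simp
      ring
    rw [this]
    positivity

theorem perm_of_pow_sums {ι : Type*} [Fintype ι] {p q : ι → ℝ}
    (h : ∀ n : ℕ, ∑ i, p i ^ n = ∑ i, q i ^ n) : ∃ σ : Equiv.Perm ι, p = q ∘ σ := by
  classical
  have hpoly : ∀ F : Polynomial ℝ, ∑ i, F.eval (p i) = ∑ i, F.eval (q i) := by
    intro F
    simp only [Polynomial.eval_eq_sum_range]
    rw [Finset.sum_comm, Finset.sum_comm (s := Finset.univ)]
    refine Finset.sum_congr rfl fun n _ => ?_
    rw [← Finset.mul_sum, ← Finset.mul_sum, h n]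
  have hcard : ∀ c : ℝ, Fintype.card {i // p i = c} = Fintype.card {i // q i = c} := by
    intro c
    set V : Finset ℝ := Finset.univ.image p ∪ Finset.univ.image q with hV
    have := hpoly (Lagrange.interpolate V id (fun x => if x = c then 1 else 0))
    have hev : ∀ x ∈ V, (Lagrange.interpolate V id (fun x => if x = c then 1 else 0)).eval x
        = if x = c then (1 : ℝ) else 0 := by
      intro x hx
      exact Lagrange.eval_interpolate_at_node (v := id) _ Function.injective_id.injOn hx
    rw [Finset.sum_congr rfl fun i _ => hev (p i) (by simp [hV]),
      Finset.sum_congr rfl fun i _ => hev (q i) (by simp [hV])] at this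
    rw [Fintype.card_subtype, Fintype.card_subtype]
    simp only [Finset.sum_boole] at this
    exact_mod_cast this
  refine ⟨Equiv.ofFiberEquiv (f := p) (g := q) fun c => Fintype.equivOfCardEq (hcard c), ?_⟩
  funext i
  exact (Equiv.ofFiberEquiv_map _ i).symm

theorem maj_rank_le {ι κ : Type*} [Fintype ι] [Fintype κ] {f : ι → ℝ} {g : κ → ℝ} (hf : IsProbDist f)
    (hg : IsProbDist g) (h : Majorizes f g) : distRank f ≤ distRank g := by
  classical
  obtain ⟨B, hB, hs⟩ := h (Finset.univ.filter fun k => g k ≠ 0)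
  have h1 : ∑ k ∈ Finset.univ.filter (fun k => g k ≠ 0), g k = 1 := by
    rw [Finset.sum_filter_ne_zero, hg.2]
  rw [h1] at hs
  have h2 : ∑ i ∈ Bᶜ, f i = 0 := by
    have h3 := Finset.sum_add_sum_compl B f
    rw [hf.2] at h3
    exact le_antisymm (by linarith) (Finset.sum_nonneg fun i _ => hf.1 i)
  have h4 : ∀ i ∈ Bᶜ, f i = 0 := (Finset.sum_eq_zero_iff_of_nonneg fun i _ => hf.1 i).mp h2
  have h5 : (Finset.univ.filter fun i => f i ≠ 0) ⊆ B := by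
    intro i hi
    by_contra hcon
    exact (Finset.mem_filter.mp hi).2 (h4 i (by simpa using hcon))
  have h6 := (Finset.card_le_card h5).trans hB
  unfold distRank
  convert h6

theorem rank_kron {ι κ : Type*} [Fintype ι] [Fintype κ] (f : ι → ℝ) (g : κ → ℝ) :
    distRank (kron f g) = distRank f * distRank g := by
  classical
  unfold distRank
  rw [← Finset.card_product]
  congr 1
  ext ⟨i, k⟩
  simp [kron]

theorem prob_kron {ι κ : Type*} [Fintype ι] [Fintype κ] {f : ι → ℝ} {g : κ → ℝ}
    (hf : IsProbDist f) (hg : IsProbDist g) : IsProbDist (kron f g) := by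
  refine ⟨fun x => mul_nonneg (hf.1 _) (hg.1 _), ?_⟩
  rw [Fintype.sum_prod_type]
  simp [kron, ← Finset.mul_sum, hf.2, hg.2]

theorem entropy_kron {ι κ : Type*} [Fintype ι] [Fintype κ] {f : ι → ℝ} {g : κ → ℝ}
    (hf : IsProbDist f) (hg : IsProbDist g) :
    shannonEntropy (kron f g) = shannonEntropy f + shannonEntropy g := by
  unfold shannonEntropy
  rw [Fintype.sum_prod_type]
  have : ∀ i k, kron f g (i, k) * Real.log (kron f g (i, k)) =
      g k * (f i * Real.log (f i)) + f i * (g k * Real.log (g k)) := by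
    intro i k
    simp only [kron]
    by_cases h1 : f i = 0
    · simp [h1]
    by_cases h2 : g k = 0
    · simp [h2]
    rw [Real.log_mul h1 h2]
    ring
  simp only [this, Finset.sum_add_distrib, ← Finset.mul_sum, ← Finset.sum_mul, hf.2, hg.2]
  ring

theorem gibbs {ι : Type*} [Fintype ι] {r s : ι → ℝ} (hr : IsProbDist r) (hs : IsProbDist s)
    (hac : ∀ i, s i = 0 → r i = 0) (hlog : ∑ i, r i * Real.log (s i) = ∑ i, s i * Real.log (s i)) :
    shannonEntropy r ≤ shannonEntropy s ∧ (shannonEntropy r = shannonEntropy s → r = s) := by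
  have hpt : ∀ i, 0 ≤ r i * Real.log (r i) - r i * Real.log (s i) - r i + s i ∧
      (r i * Real.log (r i) - r i * Real.log (s i) - r i + s i = 0 → r i = s i) := by
    intro i
    by_cases h0 : s i = 0
    · simp [h0, hac i h0]
    have hs0 : 0 < s i := lt_of_le_of_ne (hs.1 i) (Ne.symm h0)
    by_cases h1 : r i = 0
    · simp [h1, hs0.le, h0]
    have hr0 : 0 < r i := lt_of_le_of_ne (hr.1 i) (Ne.symm h1)
    have e : r i * Real.log (r i) - r i * Real.log (s i) - r i + s i
        = r i * ((s i / r i - 1) - Real.log (s i / r i)) := by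
      rw [Real.log_div h0 h1]
      field_simp
      ring
    rw [e]
    constructor
    · have := Real.log_le_sub_one_of_pos (div_pos hs0 hr0)
      exact mul_nonneg hr0.le (by linarith)
    · intro h2
      by_contra hcon
      have hne : s i / r i ≠ 1 := fun h => hcon ((div_eq_one_iff_eq h1).mp h).symm
      have := Real.log_lt_sub_one_of_pos (div_pos hs0 hr0) hne
      rcases mul_eq_zero.mp h2 with h | h
      · exact h1 h
      · linarith
  have hsum : ∑ i, (r i * Real.log (r i) - r i * Real.log (s i) - r i + s i) =
      shannonEntropy s - shannonEntropy r := by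
    simp only [Finset.sum_add_distrib, Finset.sum_sub_distrib, hr.2, hs.2, hlog, shannonEntropy]
    ring
  constructor
  · have := Finset.sum_nonneg fun i (_ : i ∈ Finset.univ) => (hpt i).1
    linarith
  · intro h
    rw [h, sub_self] at hsum
    funext i
    exact (hpt i).2 ((Finset.sum_eq_zero_iff_of_nonneg fun i _ => (hpt i).1).mp hsum i
      (Finset.mem_univ i))

section
variable {k : ℕ} {d : Fin k → ℕ}

theorem sum_prod_dep (f : ∀ i, Fin (d i) → ℝ) :
    ∑ y : ∀ i, Fin (d i), ∏ i, f i (y i) = ∏ i, ∑ s, f i s := by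
  classical
  rw [Finset.prod_univ_sum]
  simp

theorem marg_prob {r : (∀ i, Fin (d i)) → ℝ} (hr : IsProbDist r) (i : Fin k) :
    IsProbDist (marginal r i) := by
  constructor
  · intro b
    exact Finset.sum_nonneg fun y _ => by split_ifs; exacts [hr.1 y, le_rfl]
  · unfold marginal
    rw [Finset.sum_comm]
    simpa using hr.2

theorem marg_ne {r : (∀ i, Fin (d i)) → ℝ} (hr : IsProbDist r) (y : ∀ i, Fin (d i)) (hy : r y ≠ 0)
    (i : Fin k) : marginal r i (y i) ≠ 0 := by
  intro h
  have := (Finset.sum_eq_zero_iff_of_nonneg (fun z _ => by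
    split_ifs; exacts [hr.1 z, le_rfl])).mp h y (Finset.mem_univ y)
  simp at this
  exact hy this

theorem prod_prob {f : ∀ i, Fin (d i) → ℝ} (hf : ∀ i, IsProbDist (f i)) :
    IsProbDist (fun y : ∀ i, Fin (d i) => ∏ i, f i (y i)) := by
  refine ⟨fun y => Finset.prod_nonneg fun i _ => (hf i).1 _, ?_⟩
  rw [sum_prod_dep]
  exact Finset.prod_eq_one fun i _ => (hf i).2

theorem marg_prod {f : ∀ i, Fin (d i) → ℝ} (hf : ∀ i, IsProbDist (f i)) (i : Fin k) :
    marginal (fun y : ∀ i, Fin (d i) => ∏ i, f i (y i)) i = f i := by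
  funext b
  unfold marginal
  have h1 : ∀ y : ∀ i, Fin (d i), (if y i = b then ∏ j, f j (y j) else 0) =
      ∏ j, (Function.update f i (fun s => if s = b then f i s else 0)) j (y j) := by
    intro y
    rw [← Finset.mul_prod_erase _ (fun j =>
        (Function.update f i (fun s => if s = b then f i s else 0)) j (y j)) (Finset.mem_univ i),
      ← Finset.mul_prod_erase _ (fun j => f j (y j)) (Finset.mem_univ i)]
    have : ∏ j ∈ Finset.univ.erase i,
        (Function.update f i (fun s => if s = b then f i s else 0)) j (y j)
        = ∏ j ∈ Finset.univ.erase i, f j (y j) := by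
      refine Finset.prod_congr rfl fun j hj => ?_
      rw [Function.update_of_ne (Finset.ne_of_mem_erase hj)]
    rw [this]
    simp
  simp only [h1]
  rw [sum_prod_dep, ← Finset.mul_prod_erase _ _ (Finset.mem_univ i)]
  rw [Finset.prod_eq_one]
  · simp
  · intro j hj
    rw [Function.update_of_ne (Finset.ne_of_mem_erase hj)]
    exact (hf j).2

theorem log_marg {s : (∀ i, Fin (d i)) → ℝ} (f : ∀ i, Fin (d i) → ℝ)
    (hm : ∀ i, marginal s i = f i) (hac : ∀ y, s y ≠ 0 → ∀ i, f i (y i) ≠ 0) :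
    ∑ y, s y * Real.log (∏ i, f i (y i)) = ∑ i, ∑ b, f i b * Real.log (f i b) := by
  have h1 : ∀ y, s y * Real.log (∏ i, f i (y i)) = ∑ i, s y * Real.log (f i (y i)) := by
    intro y
    by_cases hy : s y = 0
    · simp [hy]
    · rw [Real.log_prod fun i _ => hac y hy i, Finset.mul_sum]
  simp only [h1]
  rw [Finset.sum_comm]
  refine Finset.sum_congr rfl fun i _ => ?_
  rw [← hm i]
  unfold marginal
  simp only [Finset.sum_mul]
  rw [Finset.sum_comm]
  refine Finset.sum_congr rfl fun y _ => ?_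
  simp
end

theorem backward {m : ℕ} (p q : Fin m → ℝ)
    (hp : IsProbDist p) (hq : IsProbDist q)
    (hne : ¬ ∃ σ : Equiv.Perm (Fin m), p = q ∘ σ) (k : ℕ) (d : Fin k → ℕ)
    (r : (∀ i, Fin (d i)) → ℝ) (hr : IsProbDist r)
    (hmaj : Majorizes (kron p (fun y : ∀ i, Fin (d i) => ∏ i, marginal r i (y i))) (kron q r)) :
    distRank p ≤ distRank q ∧ shannonEntropy p < shannonEntropy q := by
  set ρ : (∀ i, Fin (d i)) → ℝ := fun y => ∏ i, marginal r i (y i) with hρ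
  have hρp : IsProbDist ρ := prod_prob (marg_prob hr)
  have hac : ∀ y, ρ y = 0 → r y = 0 := by
    intro y hy
    by_contra hcon
    exact Finset.prod_ne_zero_iff.mpr (fun i _ => marg_ne hr y hcon i) hy
  have hlog : ∑ y, r y * Real.log (ρ y) = ∑ y, ρ y * Real.log (ρ y) := by
    rw [log_marg (s := r) (marginal r) (fun _ => rfl) (fun y hy i => marg_ne hr y hy i)]
    rw [log_marg (s := ρ) (marginal r) (fun i => marg_prod (marg_prob hr) i)
      (fun y hy i => Finset.prod_ne_zero_iff.mp hy i (Finset.mem_univ i))]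
  obtain ⟨g1, g2⟩ := gibbs hr hρp hac hlog
  obtain ⟨s1, s2⟩ := schur (prob_kron hp hρp) (prob_kron hq hr) hmaj
  rw [entropy_kron hp hρp, entropy_kron hq hr] at s1 s2
  constructor
  · have h1 := maj_rank_le (prob_kron hp hρp) (prob_kron hq hr) hmaj
    rw [rank_kron, rank_kron] at h1
    have h2 : distRank r ≤ distRank ρ := by
      refine Finset.card_le_card fun y hy => ?_
      simp only [Finset.mem_filter, Finset.mem_univ, true_and] at hy ⊢
      exact fun h => hy (hac y h)
    have h3 : 0 < distRank ρ := by
      unfold distRank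
      rw [Finset.card_pos]
      by_contra hcon
      rw [Finset.not_nonempty_iff_eq_empty, Finset.filter_eq_empty_iff] at hcon
      have : ∑ y, ρ y = 0 := Finset.sum_eq_zero fun y hy => by simpa using hcon hy
      rw [hρp.2] at this
      exact one_ne_zero this
    exact Nat.le_of_mul_le_mul_right (h1.trans (Nat.mul_le_mul_left _ h2)) h3
  · refine lt_of_le_of_ne (by linarith) fun heq => hne ?_
    have hrρ : r = ρ := g2 (by linarith)
    have h1 := s2 (by rw [heq, ← hrρ])
    have h2 := pow_sums (prob_kron hp hρp) (prob_kron hq hr) h1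
    refine perm_of_pow_sums fun n => ?_
    have h3 := h2 n
    rw [hrρ, Fintype.sum_prod_type, Fintype.sum_prod_type] at h3
    simp only [kron, mul_pow, ← Finset.mul_sum, ← Finset.sum_mul] at h3
    refine mul_right_cancel₀ ?_ h3
    intro h0
    have h4 := (Finset.sum_eq_zero_iff_of_nonneg (fun y _ => pow_nonneg (hρp.1 y) n)).mp h0
    have : ∑ y, ρ y = 0 := Finset.sum_eq_zero fun y hy => eq_zero_of_pow_eq_zero (h4 y hy)
    rw [hρp.2] at this
    exact one_ne_zero this

/-- For probability distributions `p, q` that are not permutations of each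
other, a transition `p ⊗ (r₁ ⊗ … ⊗ r_k) ≻ q ⊗ r_{1…k}` (for some `k`-partite `r` with
marginals `r₁, …, r_k`) is possible iff `rank p ≤ rank q` and `H(p) < H(q)`;
moreover in that case one can take `k = 3`. -/
theorem c_trumping_characterization {m : ℕ} (p q : Fin m → ℝ)
    (hp : IsProbDist p) (hq : IsProbDist q)
    (hne : ¬ ∃ σ : Equiv.Perm (Fin m), p = q ∘ σ) :
    ((∃ (k : ℕ) (d : Fin k → ℕ) (r : (∀ i, Fin (d i)) → ℝ), IsProbDist r ∧
        Majorizes (kron p (fun y : ∀ i, Fin (d i) => ∏ i, marginal r i (y i))) (kron q r)) ↔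
      distRank p ≤ distRank q ∧ shannonEntropy p < shannonEntropy q) ∧
    (distRank p ≤ distRank q ∧ shannonEntropy p < shannonEntropy q →
      ∃ (d : Fin 3 → ℕ) (r : (∀ i, Fin (d i)) → ℝ), IsProbDist r ∧
        Majorizes (kron p (fun y : ∀ i, Fin (d i) => ∏ i, marginal r i (y i))) (kron q r)) := by
  refine ⟨⟨?_, ?_⟩, ?_⟩
  · rintro ⟨k, d, r, hr, hmaj⟩
    exact backward p q hp hq hne k d r hr hmaj
  · rintro ⟨h1, h2⟩
    obtain ⟨d, r, hr⟩ := forward p q hp hq h1 h2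
    exact ⟨3, d, r, hr⟩
  · rintro ⟨h1, h2⟩
    exact forward p q hp hq h1 h2
end

section
/- Let p, q ∈ ℝ^m be probability distributions such that q has full rank (all entries nonzero) and H(p) < H(q). Then there exists a tripartite probability distribution r_{1,2,3} with marginals r_1, r_2, r_3 such that p ⊗ (r_1 ⊗ r_2 ⊗ r_3) ≻ q ⊗ r_{1,2,3}. -/
open scoped BigOperators

lemma ct_low (ρ h κ y a : ℝ) (W : ℕ) (hρ : 1 < ρ) (hh : h = Real.log ρ) (hκ : 0 ≤ κ)
    (hy : 0 < y) (ha : 0 ≤ a) (haW : a ≤ y * ρ ^ W) :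
    a * Real.log (a / y) - h * a - κ * a ≤
      h * ∑ i ∈ Finset.range W, max (a - κ * (y * ρ ^ i)) 0 := by
  have hhpos : 0 < h := hh ▸ Real.log_pos hρ
  have hhle : h ≤ ρ - 1 := by rw [hh]; exact Real.log_le_sub_one_of_pos (by linarith)
  have hsum : 0 ≤ ∑ i ∈ Finset.range W, max (a - κ * (y * ρ ^ i)) 0 :=
    Finset.sum_nonneg fun i _ => le_max_right _ _
  rcases le_or_gt a y with hay | hay
  · have : Real.log (a / y) ≤ 0 :=
      Real.log_nonpos (by positivity) ((div_le_one hy).2 hay)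
    have h1 : a * Real.log (a / y) ≤ 0 := mul_nonpos_of_nonneg_of_nonpos ha this
    have : 0 ≤ h * ∑ i ∈ Finset.range W, max (a - κ * (y * ρ ^ i)) 0 := by positivity
    have : 0 ≤ h * a := by positivity
    have : 0 ≤ κ * a := by positivity
    linarith
  · have hapos : 0 < a := hy.trans hay
    have hdiv : 0 < a / y := by positivity
    have hlog : 0 ≤ Real.log (a / y) := Real.log_nonneg ((one_le_div hy).2 hay.le)
    set k := ⌊Real.log (a / y) / h⌋₊ with hk
    have hk1 : (k : ℝ) * h ≤ Real.log (a / y) := by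
      have := Nat.floor_le (div_nonneg hlog hhpos.le)
      rwa [← hk, le_div_iff₀ hhpos] at this
    have hk2 : Real.log (a / y) ≤ k * h + h := by
      have := Nat.lt_floor_add_one (Real.log (a / y) / h)
      rw [← hk, div_lt_iff₀ hhpos] at this
      linarith
    have hρk : y * ρ ^ k ≤ a := by
      have : ρ ^ k ≤ a / y := by
        rw [← Real.log_le_log_iff (by positivity) hdiv, Real.log_pow, ← hh]
        exact hk1
      rw [le_div_iff₀ hy] at this
      linarith
    have hkW : k ≤ W := by
      by_contra hcon
      push Not at hcon
      have : ρ ^ W < ρ ^ k := pow_lt_pow_right₀ hρ hcon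
      nlinarith
    have hge : (k : ℝ) * a - κ * y * ((ρ ^ k - 1) / (ρ - 1)) ≤
        ∑ i ∈ Finset.range W, max (a - κ * (y * ρ ^ i)) 0 := by
      calc (k : ℝ) * a - κ * y * ((ρ ^ k - 1) / (ρ - 1))
          = ∑ i ∈ Finset.range k, (a - κ * (y * ρ ^ i)) := by
            rw [← geom_sum_eq hρ.ne', Finset.sum_sub_distrib, Finset.mul_sum]
            simp [mul_assoc]
        _ ≤ ∑ i ∈ Finset.range k, max (a - κ * (y * ρ ^ i)) 0 :=
            Finset.sum_le_sum fun i _ => le_max_left _ _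
        _ ≤ _ := Finset.sum_le_sum_of_subset_of_nonneg
            (Finset.range_subset_range.2 hkW) fun i _ _ => le_max_right _ _
    have h3 : h * (κ * y * ((ρ ^ k - 1) / (ρ - 1))) ≤ κ * a := by
      have e : h * (κ * y * ((ρ ^ k - 1) / (ρ - 1))) = (h / (ρ - 1)) * (κ * (y * (ρ ^ k - 1))) := by
        field_simp
      rw [e]
      have h1 : h / (ρ - 1) ≤ 1 := (div_le_one (by linarith)).2 hhle
      have h2 : κ * (y * (ρ ^ k - 1)) ≤ κ * a := by
        apply mul_le_mul_of_nonneg_left _ hκ; linarith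
      have h4 : 0 ≤ κ * (y * (ρ ^ k - 1)) := by
        have : 1 ≤ ρ ^ k := one_le_pow₀ hρ.le
        exact mul_nonneg hκ (mul_nonneg hy.le (by linarith))
      calc _ ≤ 1 * (κ * (y * (ρ ^ k - 1))) := mul_le_mul_of_nonneg_right h1 h4
        _ ≤ _ := by linarith
    have h5 := mul_le_mul_of_nonneg_left hge hhpos.le
    have h6 : a * Real.log (a / y) ≤ a * (k * h + h) := mul_le_mul_of_nonneg_left hk2 ha
    nlinarith

lemma ct_up_aux (ρ h a : ℝ) (hρ : 1 < ρ) (hh : h = Real.log ρ) (ha : 0 < a) (N : ℕ) :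
    ∀ z : ℝ, 0 < z → h * ∑ i ∈ Finset.range N, max (a - z * ρ ^ i) 0 ≤
      a * Real.log (a / (z * (h / (ρ - 1)))) - a + z * (h / (ρ - 1)) := by
  have hhpos : 0 < h := hh ▸ Real.log_pos hρ
  have hρ1 : 0 < ρ - 1 := by linarith
  have hB : ∀ w : ℝ, 0 < w → 0 ≤ a * Real.log (a / w) - a + w := by
    intro w hw
    have := Real.one_sub_inv_le_log_of_pos (show 0 < a / w by positivity)
    have h2 := mul_le_mul_of_nonneg_left this ha.le
    have h3 : a * (1 - (a / w)⁻¹) = a - w := by field_simp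
    linarith
  induction N with
  | zero => intro z hz; simpa using hB _ (by positivity)
  | succ N ih =>
    intro z hz
    rcases le_or_gt a z with haz | haz
    · rw [Finset.sum_eq_zero, mul_zero]
      · exact hB _ (by positivity)
      · intro i _
        apply max_eq_right
        have : 1 ≤ ρ ^ i := one_le_pow₀ hρ.le
        nlinarith
    · rw [Finset.sum_range_succ']
      have h1 := ih (z * ρ) (mul_pos hz (by linarith))
      have e : ∀ i, z * ρ ^ (i + 1) = z * ρ * ρ ^ i := fun i => by ring
      simp only [e, pow_zero, mul_one]
      rw [max_eq_left (by linarith : 0 ≤ a - z), mul_add]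
      have e2 : Real.log (a / (z * ρ * (h / (ρ - 1)))) =
          Real.log (a / (z * (h / (ρ - 1)))) - h := by
        have hρ0 : 0 < ρ := by linarith
        rw [show a / (z * ρ * (h / (ρ - 1))) = a / (z * (h / (ρ - 1))) / ρ by field_simp,
          Real.log_div (by positivity) (by positivity), ← hh]
      rw [e2] at h1
      have e3 : z * ρ * (h / (ρ - 1)) = z * (h / (ρ - 1)) + z * h := by field_simp; ring
      rw [e3] at h1
      linarith

lemma ct_up (ρ h a : ℝ) (hρ : 1 < ρ) (hh : h = Real.log ρ) (ha : 0 < a) (N : ℕ)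
    (z : ℝ) (hz : 0 < z) : h * ∑ i ∈ Finset.range N, max (a - z * ρ ^ i) 0 ≤
      a * Real.log (a / z) + h * a - a + z := by
  have hhpos : 0 < h := hh ▸ Real.log_pos hρ
  have hρ1 : 0 < ρ - 1 := by linarith
  have hhle : h ≤ ρ - 1 := by rw [hh]; exact Real.log_le_sub_one_of_pos (by linarith)
  have h0 := ct_up_aux ρ h a hρ hh ha N z hz
  have h1 : z * (h / (ρ - 1)) ≤ z := mul_le_of_le_one_right hz.le ((div_le_one hρ1).2 hhle)
  have h2 : Real.log (a / (z * (h / (ρ - 1)))) = Real.log (a / z) + Real.log ((ρ - 1) / h) := by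
    rw [← Real.log_mul (by positivity) (by positivity)]
    congr 1
    field_simp
  have h3 : Real.log ((ρ - 1) / h) ≤ h := by
    rw [hh]
    apply Real.log_le_log (by rw [← hh]; positivity)
    rw [← hh, div_le_iff₀ hhpos]
    have := Real.one_sub_inv_le_log_of_pos (show 0 < ρ by linarith)
    rw [← hh] at this
    have h5 := mul_le_mul_of_nonneg_left this (show 0 ≤ ρ by linarith)
    have h6 : ρ * (1 - ρ⁻¹) = ρ - 1 := by field_simp
    linarith
  rw [h2] at h0
  have := mul_le_mul_of_nonneg_left h3 ha.le
  linarith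

lemma ct_topk {ι : Type*} [Fintype ι] (P : ι → ℝ) (hP : ∀ i, 0 ≤ P i) (k : ℕ)
    (hk : k ≤ Fintype.card ι) : ∃ (B : Finset ι) (c : ℝ), B.card = k ∧ 0 ≤ c ∧
      (∀ b ∈ B, c ≤ P b) ∧ ∀ a, a ∉ B → P a ≤ c := by
  classical
  induction k with
  | zero => exact ⟨∅, ∑ i, P i, rfl, Finset.sum_nonneg fun i _ => hP i, by simp,
      fun a _ => Finset.single_le_sum (fun i _ => hP i) (Finset.mem_univ a)⟩
  | succ k ih =>
    obtain ⟨B, c, hB, hc, h1, h2⟩ := ih (by omega)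
    have hne : (Bᶜ).Nonempty := by
      rw [← Finset.card_pos, Finset.card_compl]; omega
    obtain ⟨x, hx, hmax⟩ := Finset.exists_max_image Bᶜ P hne
    have hx' : x ∉ B := by simpa using hx
    refine ⟨insert x B, P x, by rw [Finset.card_insert_of_notMem hx', hB], hP x, ?_, ?_⟩
    · intro b hb
      rcases Finset.mem_insert.1 hb with rfl | hb
      · exact le_rfl
      · exact (h2 x hx').trans (h1 b hb)
    · intro a ha
      rw [Finset.mem_insert, not_or] at ha
      exact hmax a (by simpa using ha.2)

lemma ct_majorizes {ι κ : Type*} [Fintype ι] [Fintype κ] (P : ι → ℝ) (Q : κ → ℝ)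
    (hP : ∀ i, 0 ≤ P i)
    (h : ∀ c : ℝ, 0 ≤ c → ∑ j, max (Q j - c) 0 ≤ ∑ i, max (P i - c) 0) : Majorizes P Q := by
  classical
  intro A
  have key : ∀ c : ℝ, ∑ j ∈ A, Q j ≤ A.card * c + ∑ j, max (Q j - c) 0 := by
    intro c
    calc ∑ j ∈ A, Q j = A.card * c + ∑ j ∈ A, (Q j - c) := by
          rw [Finset.sum_sub_distrib]; simp
      _ ≤ A.card * c + ∑ j ∈ A, max (Q j - c) 0 := by
          exact add_le_add le_rfl (Finset.sum_le_sum fun j _ => le_max_left _ _)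
      _ ≤ _ := by
          exact add_le_add le_rfl (Finset.sum_le_sum_of_subset_of_nonneg (Finset.subset_univ _)
            fun i _ _ => le_max_right _ _)
  rcases le_or_gt A.card (Fintype.card ι) with hA | hA
  · obtain ⟨B, c, hB, hc, h1, h2⟩ := ct_topk P hP A.card hA
    refine ⟨B, hB.le, ?_⟩
    have e : ∑ i, max (P i - c) 0 = ∑ i ∈ B, (P i - c) := by
      rw [← Finset.sum_subset (Finset.subset_univ B)]
      · exact Finset.sum_congr rfl fun i hi => max_eq_left (by linarith [h1 i hi])
      · intro i _ hi
        exact max_eq_right (by linarith [h2 i hi])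
    have e2 : ∑ i ∈ B, P i = A.card * c + ∑ i ∈ B, (P i - c) := by
      rw [Finset.sum_sub_distrib]; simp [hB]
    linarith [key c, h c hc]
  · refine ⟨Finset.univ, by rw [Finset.card_univ]; exact hA.le, ?_⟩
    have e : ∑ i, max (P i - 0) 0 = ∑ i, P i :=
      Finset.sum_congr rfl fun i _ => by rw [sub_zero, max_eq_left (hP i)]
    have := key 0
    have := h 0 le_rfl
    linarith

noncomputable def ctG {m : ℕ} (q : Fin m → ℝ) (z : ℝ) : ℝ := ∑ x, max (q x - z) 0

lemma ctG_nonneg {m : ℕ} (q : Fin m → ℝ) (z : ℝ) : 0 ≤ ctG q z :=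
  Finset.sum_nonneg fun _ _ => le_max_right _ _

lemma ctG_le_one {m : ℕ} (q : Fin m → ℝ) (hq : IsProbDist q) (z : ℝ) (hz : 0 ≤ z) :
    ctG q z ≤ 1 := by
  rw [← hq.2]
  exact Finset.sum_le_sum fun x _ => max_le (by linarith) (hq.1 x)

lemma ct_le_one {m : ℕ} (q : Fin m → ℝ) (hq : IsProbDist q) (x : Fin m) : q x ≤ 1 := by
  rw [← hq.2]
  exact Finset.single_le_sum (fun i _ => hq.1 i) (Finset.mem_univ x)

lemma ctG_eq_zero {m : ℕ} (q : Fin m → ℝ) (hq : IsProbDist q) (z : ℝ) (hz : 1 ≤ z) :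
    ctG q z = 0 :=
  Finset.sum_eq_zero fun x _ => max_eq_right (by linarith [ct_le_one q hq x])

lemma ctG_ge {m : ℕ} (q : Fin m → ℝ) (hq : IsProbDist q) (z : ℝ) : 1 - m * z ≤ ctG q z := by
  have : ∑ x, (q x - z) ≤ ctG q z := Finset.sum_le_sum fun x _ => le_max_left _ _
  rw [Finset.sum_sub_distrib, hq.2] at this
  simpa using this

lemma ctG_le {m : ℕ} (q : Fin m → ℝ) (hq : IsProbDist q) (z a : ℝ) (x : Fin m)
    (hz : a ≤ z) (ha : 0 ≤ a) (hx : a ≤ q x) : ctG q z ≤ 1 - a := by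
  classical
  have h1 : ∑ y, max (q y - z) 0 ≤ ∑ y, (q y - if y = x then a else 0) := by
    apply Finset.sum_le_sum
    intro y _
    split_ifs with h
    · subst h; exact max_le (by linarith) (by linarith)
    · exact max_le (by linarith) (by linarith [hq.1 y])
  rw [Finset.sum_sub_distrib, hq.2] at h1
  simpa [ctG] using h1

lemma ct_entropy {m : ℕ} (p : Fin m → ℝ) (hp : IsProbDist p) (y : ℝ) (hy : 0 < y) :
    ∑ x, p x * Real.log (p x / y) = -shannonEntropy p - Real.log y := by
  have : ∀ x, p x * Real.log (p x / y) = p x * Real.log (p x) - p x * Real.log y := by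
    intro x
    rcases eq_or_ne (p x) 0 with h | h
    · simp [h]
    · rw [Real.log_div h hy.ne', mul_sub]
  simp only [this, Finset.sum_sub_distrib, ← Finset.sum_mul, hp.2, shannonEntropy]
  ring

/-- lower bound on the sum for `p` -/
lemma ctG_sum_low {m : ℕ} (p : Fin m → ℝ) (hp : IsProbDist p) (ρ h κ y : ℝ) (W : ℕ)
    (hρ : 1 < ρ) (hh : h = Real.log ρ) (hκ : 0 ≤ κ) (hy : 0 < y) (hW : 1 ≤ y * ρ ^ W) :
    -shannonEntropy p - Real.log y - h - κ ≤
      h * ∑ i ∈ Finset.range W, ctG p (κ * (y * ρ ^ i)) := by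
  have h1 : ∑ x, (p x * Real.log (p x / y) - h * p x - κ * p x) ≤
      ∑ x, h * ∑ i ∈ Finset.range W, max (p x - κ * (y * ρ ^ i)) 0 :=
    Finset.sum_le_sum fun x _ => ct_low ρ h κ y (p x) W hρ hh hκ hy (hp.1 x)
      ((ct_le_one p hp x).trans hW)
  rw [Finset.sum_sub_distrib, Finset.sum_sub_distrib, ct_entropy p hp y hy, ← Finset.mul_sum,
    ← Finset.mul_sum, ← Finset.mul_sum, hp.2, Finset.sum_comm] at h1
  simpa [ctG] using h1

lemma ctG_sum_up {m : ℕ} (q : Fin m → ℝ) (hq : IsProbDist q) (hq0 : ∀ x, 0 < q x)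
    (ρ h z : ℝ) (N : ℕ) (hρ : 1 < ρ) (hh : h = Real.log ρ) (hz : 0 < z) :
    h * ∑ i ∈ Finset.range N, ctG q (z * ρ ^ i) ≤
      -shannonEntropy q - Real.log z + h - 1 + m * z := by
  have h1 : ∑ x, h * ∑ i ∈ Finset.range N, max (q x - z * ρ ^ i) 0 ≤
      ∑ x, (q x * Real.log (q x / z) + h * q x - q x + z) :=
    Finset.sum_le_sum fun x _ => ct_up ρ h (q x) hρ hh (hq0 x) N z hz
  rw [Finset.sum_add_distrib, Finset.sum_sub_distrib, Finset.sum_add_distrib,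
    ct_entropy q hq z hz, ← Finset.mul_sum,
    ← Finset.mul_sum, hq.2, Finset.sum_comm] at h1
  simpa [ctG] using h1

lemma ctG_sum_crude {m : ℕ} (q : Fin m → ℝ) (hq : IsProbDist q)
    (ρ h z z0 : ℝ) (N : ℕ) (hρ : 1 < ρ) (hh : h = Real.log ρ) (hz0 : 0 < z0) (hz1 : z0 ≤ 1)
    (hz : z0 ≤ z) :
    h * ∑ i ∈ Finset.range N, ctG q (z * ρ ^ i) ≤ - Real.log z0 + h := by
  have hhpos : 0 < h := hh ▸ Real.log_pos hρ
  set k := ⌈-Real.log z0 / h⌉₊ with hk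
  have hlog : 0 ≤ -Real.log z0 := by linarith [Real.log_nonpos hz0.le hz1]
  have hk1 : (k : ℝ) * h ≤ -Real.log z0 + h := by
    have := Nat.ceil_lt_add_one (div_nonneg hlog hhpos.le)
    rw [← hk, ← sub_lt_iff_lt_add, lt_div_iff₀ hhpos] at this
    linarith
  have hk2 : 1 ≤ z * ρ ^ k := by
    have h1 : -Real.log z0 ≤ k * h := by
      have := Nat.le_ceil (-Real.log z0 / h)
      rwa [← hk, div_le_iff₀ hhpos] at this
    have h2 : 0 ≤ Real.log (z0 * ρ ^ k) := by
      rw [Real.log_mul hz0.ne' (by positivity), Real.log_pow, ← hh]; linarith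
    have h3 : 1 ≤ z0 * ρ ^ k := by
      by_contra hcon
      push Not at hcon
      linarith [Real.log_neg (by positivity) hcon]
    exact h3.trans (mul_le_mul_of_nonneg_right hz (by positivity))
  have hz' : 0 < z := hz0.trans_le hz
  have : ∑ i ∈ Finset.range N, ctG q (z * ρ ^ i) ≤ k := by
    calc ∑ i ∈ Finset.range N, ctG q (z * ρ ^ i)
        ≤ ∑ i ∈ Finset.range N, (if i < k then (1 : ℝ) else 0) := by
          apply Finset.sum_le_sum
          intro i _
          split_ifs with hi
          · exact ctG_le_one q hq _ (by positivity)
          · rw [ctG_eq_zero q hq]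
            refine hk2.trans (mul_le_mul_of_nonneg_left ?_ hz'.le)
            exact pow_le_pow_right₀ hρ.le (by omega)
      _ = ((Finset.range N).filter (· < k)).card := by
          rw [Finset.sum_ite]; simp
      _ ≤ k := by
          have : (Finset.range N).filter (· < k) ⊆ Finset.range k := by
            intro i; simp
          exact_mod_cast (Finset.card_le_card this).trans (by simp)
  nlinarith

/-- The zone estimate. -/
lemma ct_zone {m : ℕ} (p q : Fin m → ℝ) (hp : IsProbDist p) (hq : IsProbDist q)
    (qm : ℝ) (hqm : 0 < qm) (hq0 : ∀ x, qm ≤ q x)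
    (ρ h κ z0 b ε : ℝ) (l M : ℕ)
    (hρ : 1 < ρ) (hρ2 : ρ ≤ 2) (hh : h = Real.log ρ) (hκ : 1 ≤ κ) (hκ2 : κ ≤ 2)
    (hl : 0 < l) (hz0 : 0 < z0) (hz1 : z0 ≤ 1) (hb : 0 < b) (hε : 0 ≤ ε)
    (H1 : 2 * h + (κ - 1) + m * z0 + h * ε ≤ shannonEntropy q - shannonEntropy p)
    (H2 : 2 * (-Real.log z0 + h) + shannonEntropy p + h + κ + h * ε ≤ - Real.log b)
    (H3 : m * 2 / (ρ - 1) + ε ≤ l)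
    (H4 : m * 2 / (ρ - 1) / ρ ^ l + ε ≤ qm / 4)
    (y : ℝ) (hy : 0 < y) (hyb : y ≤ b) (hyW : qm / 2 ≤ y * ρ ^ (2 * l + M + 2 * l) * ρ ^ (2 * l)) :
    ∑ i ∈ Finset.range (2 * l), ctG q (y * ρ ^ (2 * l) * ρ ^ i) +
      ∑ i ∈ Finset.range M, ctG q (y * ρ ^ (2 * l) * ρ ^ i) +
      ∑ i ∈ Finset.range (2 * l), ctG q (y * ρ ^ (2 * l + M + 2 * l) * ρ ^ i) + ε ≤
    ∑ i ∈ Finset.range (2 * l + M + 2 * l), ctG p (κ * (y * ρ ^ i)) := by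
  have hhpos : 0 < h := hh ▸ Real.log_pos hρ
  have hρ0 : 0 < ρ := by linarith
  have hρ1 : 0 < ρ - 1 := by linarith
  set W := 2 * l + M + 2 * l with hWdef
  have hm : 0 < m := by
    rcases Nat.eq_zero_or_pos m with rfl | h
    · have := hq.2; simp at this
    · exact h
  rcases le_or_gt 1 (y * ρ ^ W) with hw | hw
  · -- top / middle zone
    have hthird : ∑ i ∈ Finset.range (2 * l), ctG q (y * ρ ^ W * ρ ^ i) = 0 := by
      apply Finset.sum_eq_zero
      intro i _
      apply ctG_eq_zero q hq
      have : 1 ≤ ρ ^ i := one_le_pow₀ hρ.le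
      nlinarith
    rw [hthird]
    have hlow := ctG_sum_low p hp ρ h κ y W hρ hh (by linarith) hy hw
    refine le_of_mul_le_mul_left ?_ hhpos
    refine le_trans ?_ hlow
    have hzpos : 0 < y * ρ ^ (2 * l) := by positivity
    rcases le_or_gt z0 (y * ρ ^ (2 * l)) with hz | hz
    · have c1 := ctG_sum_crude q hq ρ h _ z0 (2 * l) hρ hh hz0 hz1 hz
      have c2 := ctG_sum_crude q hq ρ h _ z0 M hρ hh hz0 hz1 hz
      have c3 : Real.log y ≤ Real.log b := Real.log_le_log hy hyb
      nlinarith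
    · have c1 : ∑ i ∈ Finset.range (2 * l), ctG q (y * ρ ^ (2 * l) * ρ ^ i) ≤ (2 * l : ℕ) := by
        calc _ ≤ ∑ i ∈ Finset.range (2 * l), (1 : ℝ) :=
              Finset.sum_le_sum fun i _ => ctG_le_one q hq _ (by positivity)
          _ = _ := by simp
      have c2 := ctG_sum_up q hq (fun x => hqm.trans_le (hq0 x)) ρ h _ M hρ hh hzpos
      have c3 : Real.log (y * ρ ^ (2 * l)) = Real.log y + (2 * l : ℕ) * h := by
        rw [Real.log_mul hy.ne' (by positivity), Real.log_pow, hh]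
      rw [c3] at c2
      have c4 : (m : ℝ) * (y * ρ ^ (2 * l)) ≤ m * z0 := by gcongr
      have c5 := mul_le_mul_of_nonneg_left c1 hhpos.le
      linarith
  · -- bottom zone
    set w := y * ρ ^ W with hwdef
    have hwpos : 0 < w := by positivity
    have e1 : ∑ i ∈ Finset.range (2 * l), ctG q (y * ρ ^ (2 * l) * ρ ^ i) ≤ (2 * l : ℕ) := by
      calc _ ≤ ∑ i ∈ Finset.range (2 * l), (1 : ℝ) :=
            Finset.sum_le_sum fun i _ => ctG_le_one q hq _ (by positivity)
        _ = _ := by simp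
    have e2 : ∑ i ∈ Finset.range M, ctG q (y * ρ ^ (2 * l) * ρ ^ i) ≤ (M : ℕ) := by
      calc _ ≤ ∑ i ∈ Finset.range M, (1 : ℝ) :=
            Finset.sum_le_sum fun i _ => ctG_le_one q hq _ (by positivity)
        _ = _ := by simp
    have e3 : (W : ℝ) - m * 2 / (ρ - 1) * w ≤
        ∑ i ∈ Finset.range W, ctG p (κ * (y * ρ ^ i)) := by
      calc (W : ℝ) - m * 2 / (ρ - 1) * w
          ≤ (W : ℝ) - m * κ * y * ((ρ ^ W - 1) / (ρ - 1)) := by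
            have : m * κ * y * ((ρ ^ W - 1) / (ρ - 1)) ≤ m * 2 * y * (ρ ^ W / (ρ - 1)) := by
              have : 1 ≤ ρ ^ W := one_le_pow₀ hρ.le
              have a1 : (ρ ^ W - 1) / (ρ - 1) ≤ ρ ^ W / (ρ - 1) :=
                div_le_div_of_nonneg_right (by linarith) hρ1.le
              have a2 : 0 ≤ (ρ ^ W - 1) / (ρ - 1) := div_nonneg (by linarith) hρ1.le
              have a3 : m * κ * y ≤ m * 2 * y := by gcongr
              exact mul_le_mul a3 a1 a2 (by positivity)
            have e : m * 2 * y * (ρ ^ W / (ρ - 1)) = m * 2 / (ρ - 1) * w := by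
              rw [hwdef]; field_simp
            linarith
        _ = ∑ i ∈ Finset.range W, (1 - m * (κ * (y * ρ ^ i))) := by
            rw [← geom_sum_eq hρ.ne', Finset.sum_sub_distrib, Finset.mul_sum]
            simp [mul_assoc]
        _ ≤ _ := Finset.sum_le_sum fun i _ => ctG_ge p hp _
    have hW' : (W : ℝ) = (2 * l : ℕ) + M + (2 * l : ℕ) := by rw [hWdef]; push_cast; ring
    have hcpos : 0 ≤ m * 2 / (ρ - 1) := by positivity
    suffices hs : ∑ i ∈ Finset.range (2 * l), ctG q (w * ρ ^ i) +
        (m * 2 / (ρ - 1) * w + ε) ≤ (2 * l : ℕ) by linarith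
    rcases le_or_gt 1 (w * ρ ^ l) with hwl | hwl
    · have c1 : ∑ i ∈ Finset.range (2 * l), ctG q (w * ρ ^ i) ≤ l := by
        rw [two_mul, Finset.sum_range_add]
        have z : ∑ i ∈ Finset.range l, ctG q (w * ρ ^ (l + i)) = 0 := by
          apply Finset.sum_eq_zero
          intro i _
          apply ctG_eq_zero q hq
          rw [pow_add]
          have : 1 ≤ ρ ^ i := one_le_pow₀ hρ.le
          nlinarith
        rw [z, add_zero]
        calc _ ≤ ∑ i ∈ Finset.range l, (1 : ℝ) :=
              Finset.sum_le_sum fun i _ => ctG_le_one q hq _ (by positivity)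
          _ = _ := by simp
      have c2 : m * 2 / (ρ - 1) * w ≤ m * 2 / (ρ - 1) := mul_le_of_le_one_right hcpos hw.le
      push_cast
      linarith
    · have c1 : ∑ i ∈ Finset.range (2 * l), ctG q (w * ρ ^ i) ≤ (2 * l : ℕ) - qm / 4 := by
        obtain ⟨k, hk⟩ : ∃ k, 2 * l = k + 1 := ⟨2 * l - 1, by omega⟩
        rw [hk] at hyW ⊢
        rw [Finset.sum_range_succ]
        have a1 : ∑ i ∈ Finset.range k, ctG q (w * ρ ^ i) ≤ k := by
          calc _ ≤ ∑ i ∈ Finset.range k, (1 : ℝ) :=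
                Finset.sum_le_sum fun i _ => ctG_le_one q hq _ (by positivity)
            _ = _ := by simp
        have a2 : ctG q (w * ρ ^ k) ≤ 1 - qm / 4 := by
          apply ctG_le q hq _ _ ⟨0, hm⟩ _ (by positivity) (by linarith [hq0 ⟨0, hm⟩])
          have : w * ρ ^ (k + 1) = w * ρ ^ k * ρ := by ring
          rw [this] at hyW
          have : 0 < w * ρ ^ k := by positivity
          nlinarith
        push_cast
        linarith
      have c2 : m * 2 / (ρ - 1) * w ≤ m * 2 / (ρ - 1) / ρ ^ l := by
        rw [div_eq_mul_inv _ (ρ ^ l)]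
        apply mul_le_mul_of_nonneg_left _ hcpos
        rw [← one_div, le_div_iff₀ (by positivity)]
        exact hwl.le
      linarith

noncomputable def ctT (l M : ℕ) (b : ℝ) (i : ℕ) : ℝ :=
  if i < 2 * l ∨ 2 * l + M ≤ i then 1 - b else b

lemma ct_pside {m : ℕ} (p : Fin m → ℝ) (hp : IsProbDist p) (ρ κ β y : ℝ) (l M : ℕ)
    (hρ : 1 < ρ) (hκ : 1 ≤ κ) (hβ0 : 0 ≤ β) (hβ1 : β ≤ 1) (hκβ : 1 ≤ κ * (1 - β))
    (hκρ : 1 ≤ (κ - 1) * ρ ^ (2 * l)) (hy : 0 ≤ y) :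
    ∑ i ∈ Finset.range (2 * l + M + 2 * l), ctG p (κ * (y * ρ ^ i)) - 2 * (2 * l) * β ≤
    ∑ i ∈ Finset.range (2 * l + M + 2 * l), ∑ x, (max ((1 - β) * p x - y * ρ ^ i) 0 +
      max (β * p x - y * ρ ^ (i + 2 * l)) 0) := by
  have hρ0 : 0 < ρ := by linarith
  have e : 2 * l + M + 2 * l = (2 * l + 2 * l) + M := by ring
  simp_rw [Finset.sum_add_distrib]
  have hB : ∑ i ∈ Finset.range M, ∑ x, max (β * p x - y * ρ ^ (i + 2 * l)) 0 ≤
      ∑ i ∈ Finset.range (2 * l + M + 2 * l), ∑ x, max (β * p x - y * ρ ^ (i + 2 * l)) 0 := by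
    apply Finset.sum_le_sum_of_subset_of_nonneg
    · intro i; simp only [Finset.mem_range]; omega
    · intro i _ _
      exact Finset.sum_nonneg fun _ _ => le_max_right _ _
  have hA1 : ∑ i ∈ Finset.range (2 * l + 2 * l), ctG p (κ * (y * ρ ^ i)) - 2 * (2 * l) * β ≤
      ∑ i ∈ Finset.range (2 * l + 2 * l), ∑ x, max ((1 - β) * p x - y * ρ ^ i) 0 := by
    have : ∑ i ∈ Finset.range (2 * l + 2 * l), (ctG p (κ * (y * ρ ^ i)) - β) ≤
      ∑ i ∈ Finset.range (2 * l + 2 * l), ∑ x, max ((1 - β) * p x - y * ρ ^ i) 0 := by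
      apply Finset.sum_le_sum
      intro i _
      have e2 : β = ∑ x, β * p x := by rw [← Finset.mul_sum, hp.2, mul_one]
      unfold ctG
      conv_lhs => rw [e2]
      rw [← Finset.sum_sub_distrib]
      apply Finset.sum_le_sum
      intro x _
      have hz : 0 ≤ y * ρ ^ i := by positivity
      set z := y * ρ ^ i
      have hpx := hp.1 x
      rcases le_total (p x - κ * z) 0 with h | h
      · rw [max_eq_right h]
        have := le_max_right ((1 - β) * p x - z) 0
        have := mul_nonneg hβ0 hpx
        linarith
      · rw [max_eq_left h]
        have := le_max_left ((1 - β) * p x - z) 0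
        nlinarith
    rw [Finset.sum_sub_distrib] at this
    simp only [Finset.sum_const, Finset.card_range, nsmul_eq_mul] at this
    push_cast at this
    linarith
  have hA2 : ∑ i ∈ Finset.range M, ctG p (κ * (y * ρ ^ (2 * l + 2 * l + i))) ≤
      ∑ i ∈ Finset.range M, ∑ x, max ((1 - β) * p x - y * ρ ^ (2 * l + 2 * l + i)) 0 +
      ∑ i ∈ Finset.range M, ∑ x, max (β * p x - y * ρ ^ (i + 2 * l)) 0 := by
    simp_rw [← Finset.sum_add_distrib]
    apply Finset.sum_le_sum
    intro i _
    apply Finset.sum_le_sum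
    intro x _
    have hz : 0 ≤ y * ρ ^ (i + 2 * l) := by positivity
    have e3 : y * ρ ^ (2 * l + 2 * l + i) = y * ρ ^ (i + 2 * l) * ρ ^ (2 * l) := by
      rw [mul_assoc, ← pow_add]; congr 2; omega
    rw [e3]
    set z := y * ρ ^ (i + 2 * l)
    apply max_le
    · have h1 := le_max_left ((1 - β) * p x - z * ρ ^ (2 * l)) 0
      have h2 := le_max_left (β * p x - z) 0
      nlinarith
    · positivity
  rw [e] at hB ⊢
  rw [Finset.sum_range_add (fun i => ctG p _), Finset.sum_range_add
    (fun i => ∑ x, max ((1 - β) * p x - y * ρ ^ i) 0)]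
  linarith

lemma ct_qside {m : ℕ} (q : Fin m → ℝ) (hq : IsProbDist q) (ρ b y : ℝ) (l M : ℕ)
    (hρ : 1 < ρ) (hb0 : 0 ≤ b) (hb1 : b ≤ 1) (hy : 0 ≤ y) :
    ∑ i ∈ Finset.range (2 * l + M + 2 * l), ∑ x, (max ((1 - ctT l M b i) * q x - y * ρ ^ i) 0 +
      max (ctT l M b i * q x - y * ρ ^ (i + 2 * l)) 0) ≤
    ∑ i ∈ Finset.range (2 * l), ctG q (y * ρ ^ (2 * l) * ρ ^ i) +
      ∑ i ∈ Finset.range M, ctG q (y * ρ ^ (2 * l) * ρ ^ i) +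
      ∑ i ∈ Finset.range (2 * l), ctG q (y * ρ ^ (2 * l + M + 2 * l) * ρ ^ i) +
      (2 * l + M + 2 * l : ℕ) * b := by
  have hρ0 : 0 < ρ := by linarith
  have key : ∀ i, ∑ x, (max ((1 - ctT l M b i) * q x - y * ρ ^ i) 0 +
      max (ctT l M b i * q x - y * ρ ^ (i + 2 * l)) 0) ≤
      (if i < 2 * l ∨ 2 * l + M ≤ i then ctG q (y * ρ ^ (i + 2 * l)) else ctG q (y * ρ ^ i))
        + b := by
    intro i
    have e2 : b = ∑ x, b * q x := by rw [← Finset.mul_sum, hq.2, mul_one]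
    have h1 : 0 ≤ y * ρ ^ i := by positivity
    have h2 : 0 ≤ y * ρ ^ (i + 2 * l) := by positivity
    have m1 : ∀ a z : ℝ, 0 ≤ a → 0 ≤ z → max (b * a - z) 0 ≤ b * a := by
      intro a z ha hz
      exact max_le (by linarith) (by positivity)
    have m2 : ∀ a z : ℝ, 0 ≤ a → 0 ≤ z → max ((1 - b) * a - z) 0 ≤ max (a - z) 0 := by
      intro a z ha hz
      exact max_le_max (by nlinarith) le_rfl
    unfold ctT ctG
    split_ifs with h
    · calc _ ≤ ∑ x, (max (q x - y * ρ ^ (i + 2 * l)) 0 + b * q x) := by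
            apply Finset.sum_le_sum
            intro x _
            have := m1 (q x) _ (hq.1 x) h1
            have := m2 (q x) _ (hq.1 x) h2
            rw [show 1 - (1 - b) = b by ring]
            linarith
        _ = _ := by rw [Finset.sum_add_distrib, ← e2]
    · calc _ ≤ ∑ x, (max (q x - y * ρ ^ i) 0 + b * q x) := by
            apply Finset.sum_le_sum
            intro x _
            have := m1 (q x) _ (hq.1 x) h2
            have := m2 (q x) _ (hq.1 x) h1
            linarith
        _ = _ := by rw [Finset.sum_add_distrib, ← e2]
  refine (Finset.sum_le_sum fun i _ => key i).trans ?_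
  rw [Finset.sum_add_distrib, Finset.sum_const, Finset.card_range, nsmul_eq_mul]
  gcongr
  rw [Finset.sum_range_add, Finset.sum_range_add]
  gcongr with i hi i hi i hi
  · rw [Finset.mem_range] at hi
    rw [if_pos (Or.inl hi)]
    apply le_of_eq; congr 1; ring
  · rw [Finset.mem_range] at hi
    rw [if_neg (by omega)]
    apply le_of_eq; congr 1; ring
  · rw [if_pos (Or.inr (by omega))]
    apply le_of_eq; congr 1; ring

lemma ct_hockey {m : ℕ} (p q : Fin m → ℝ) (hp : IsProbDist p) (hq : IsProbDist q)
    (qm : ℝ) (hqm : 0 < qm) (hq0 : ∀ x, qm ≤ q x)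
    (ρ h κ z0 b β ε : ℝ) (l M : ℕ)
    (hρ : 1 < ρ) (hρ2 : ρ ≤ 2) (hh : h = Real.log ρ) (hκ : 1 ≤ κ) (hκ2 : κ ≤ 2)
    (hl : 0 < l) (hz0 : 0 < z0) (hz1 : z0 ≤ 1) (hb : 0 < b) (hb2 : b ≤ 1 / 2)
    (hβ : (2 * l + M + 2 * l : ℕ) * β = ∑ i ∈ Finset.range (2 * l + M + 2 * l), ctT l M b i)
    (hβ0 : 0 ≤ β) (hβ1 : β ≤ 1)
    (hε : ε = 2 * (2 * l) * β + (2 * l + M + 2 * l : ℕ) * b)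
    (hκβ : 1 ≤ κ * (1 - β)) (hκρ : 1 ≤ (κ - 1) * ρ ^ (2 * l)) (hbρ : 1 ≤ b * ρ ^ (2 * l))
    (H1 : 2 * h + (κ - 1) + m * z0 + h * ε ≤ shannonEntropy q - shannonEntropy p)
    (H2 : 2 * (-Real.log z0 + h) + shannonEntropy p + h + κ + h * ε ≤ - Real.log b)
    (H3 : m * 2 / (ρ - 1) + ε ≤ l)
    (H4 : m * 2 / (ρ - 1) / ρ ^ l + ε ≤ qm / 4)
    (y : ℝ) (hy : 0 ≤ y) :
    ∑ i ∈ Finset.range (2 * l + M + 2 * l), ∑ x, (max ((1 - ctT l M b i) * q x - y * ρ ^ i) 0 +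
      max (ctT l M b i * q x - y * ρ ^ (i + 2 * l)) 0) ≤
    ∑ i ∈ Finset.range (2 * l + M + 2 * l), ∑ x, (max ((1 - β) * p x - y * ρ ^ i) 0 +
      max (β * p x - y * ρ ^ (i + 2 * l)) 0) := by
  have hρ0 : 0 < ρ := by linarith
  have hε0 : 0 ≤ ε := by rw [hε]; positivity
  rcases le_or_gt b y with hyb | hyb
  · -- everything vanishes on the left
    have hz : ∀ i, ∀ x, (max ((1 - ctT l M b i) * q x - y * ρ ^ i) 0 +
      max (ctT l M b i * q x - y * ρ ^ (i + 2 * l)) 0) = 0 := by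
      intro i x
      have hx0 := hq.1 x
      have hx1 := ct_le_one q hq x
      have p1 : 1 ≤ ρ ^ i := one_le_pow₀ hρ.le
      have p2 : 1 ≤ ρ ^ (2 * l) := one_le_pow₀ hρ.le
      have a1 : y ≤ y * ρ ^ i := le_mul_of_one_le_right hy p1
      have a2 : 1 ≤ y * ρ ^ (2 * l) := hbρ.trans (by gcongr)
      have a3 : 1 ≤ y * ρ ^ (i + 2 * l) := a2.trans (by
        gcongr
        · exact hρ.le
        · omega)
      have : max (ctT l M b i * q x - y * ρ ^ (i + 2 * l)) 0 = 0 := by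
        apply max_eq_right
        unfold ctT; split_ifs <;> nlinarith
      rw [this]
      have : max ((1 - ctT l M b i) * q x - y * ρ ^ i) 0 = 0 := by
        apply max_eq_right
        unfold ctT; split_ifs with hi
        · nlinarith
        · have : y * ρ ^ (2 * l) ≤ y * ρ ^ i := by
            gcongr
            · exact hρ.le
            · omega
          nlinarith
      rw [this]; simp
    calc _ = (0:ℝ) := Finset.sum_eq_zero fun i _ => Finset.sum_eq_zero fun x _ => hz i x
      _ ≤ _ := Finset.sum_nonneg fun i _ => Finset.sum_nonneg fun x _ => by positivity
  rcases le_or_gt (y * ρ ^ (2 * l + M + 2 * l) * ρ ^ (2 * l)) (qm / 2) with hu | hu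
  · -- no truncation on the left
    have hyW : y * ρ ^ (2 * l + M + 2 * l) ≤ b * (qm / 2) := by
      have : 0 ≤ y * ρ ^ (2 * l + M + 2 * l) := by positivity
      nlinarith
    have hL : ∀ i ∈ Finset.range (2 * l + M + 2 * l),
        ∑ x, (max ((1 - ctT l M b i) * q x - y * ρ ^ i) 0 +
          max (ctT l M b i * q x - y * ρ ^ (i + 2 * l)) 0) =
        1 - m * (y * ρ ^ i + y * ρ ^ (i + 2 * l)) := by
      intro i hi
      rw [Finset.mem_range] at hi
      have c1 : y * ρ ^ i ≤ y * ρ ^ (2 * l + M + 2 * l) := by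
        gcongr
        exact hρ.le
      have c2 : y * ρ ^ (i + 2 * l) ≤ qm / 2 := by
        refine le_trans ?_ hu
        rw [mul_assoc, ← pow_add]
        gcongr
        exact hρ.le
      have c3 : y * ρ ^ i ≤ y * ρ ^ (i + 2 * l) := by
        gcongr
        · exact hρ.le
        · omega
      have : ∀ x, (max ((1 - ctT l M b i) * q x - y * ρ ^ i) 0 +
          max (ctT l M b i * q x - y * ρ ^ (i + 2 * l)) 0) =
          q x - (y * ρ ^ i + y * ρ ^ (i + 2 * l)) := by
        intro x
        have hx := hq0 x
        have hb' : b * qm ≤ b * q x := by gcongr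
        have hb'' : (1 / 2) * q x ≤ (1 - b) * q x :=
          mul_le_mul_of_nonneg_right (by linarith) (hq.1 x)
        have hb3 : 0 ≤ b * qm := by positivity
        have e4 : b * (qm / 2) = b * qm / 2 := by ring
        rw [e4] at hyW
        unfold ctT
        split_ifs with h
        · rw [sub_sub_cancel, max_eq_left, max_eq_left]
          · ring
          · linarith
          · linarith
        · have : y * ρ ^ (i + 2 * l) ≤ y * ρ ^ (2 * l + M + 2 * l) := by
            gcongr
            · exact hρ.le
            · omega
          rw [max_eq_left, max_eq_left]
          · ring
          · linarith
          · linarith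
      rw [Finset.sum_congr rfl fun x _ => this x, Finset.sum_sub_distrib, hq.2]
      simp
      ring
    rw [Finset.sum_congr rfl hL]
    apply Finset.sum_le_sum
    intro i _
    calc 1 - m * (y * ρ ^ i + y * ρ ^ (i + 2 * l))
        = ∑ x, (p x - (y * ρ ^ i + y * ρ ^ (i + 2 * l))) := by
          rw [Finset.sum_sub_distrib, hp.2]; simp; ring
      _ ≤ _ := by
          apply Finset.sum_le_sum
          intro x _
          have := le_max_left ((1 - β) * p x - y * ρ ^ i) 0
          have := le_max_left (β * p x - y * ρ ^ (i + 2 * l)) 0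
          linarith
  · have hy0 : 0 < y := by
      rcases hy.eq_or_lt with h0 | h0
      · rw [← h0] at hu; simp at hu; linarith
      · exact h0
    have h1 := ct_qside q hq ρ b y l M hρ hb.le (by linarith) hy
    have h2 := ct_pside p hp ρ κ β y l M hρ hκ hβ0 hβ1 hκβ hκρ hy
    have h3 := ct_zone p q hp hq qm hqm hq0 ρ h κ z0 b ε l M hρ hρ2 hh hκ hκ2 hl hz0 hz1 hb hε0
      H1 H2 H3 H4 y hy0 hyb.le hu.le
    rw [hε] at h3
    linarith

lemma ct_transfer {m : ℕ} (p q : Fin m → ℝ) (hp : ∀ i, 0 ≤ p i)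
    {S1 S2 : Type} [Fintype S1] [Fintype S2] (r : S1 × S2 → ℝ) (hr : IsProbDist r)
    (h : ∀ c : ℝ, 0 ≤ c → ∑ x, ∑ st : S1 × S2, max (q x * r st - c) 0 ≤
      ∑ x, ∑ st : S1 × S2, max (p x * ((∑ t, r (st.1, t)) * (∑ s, r (s, st.2))) - c) 0) :
    ∃ (d : Fin 3 → ℕ) (r : (∀ i, Fin (d i)) → ℝ), IsProbDist r ∧
      Majorizes (kron p (fun y : ∀ i, Fin (d i) => ∏ i, marginal r i (y i))) (kron q r) := by
  classical
  let e1 := Fintype.equivFin S1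
  let e2 := Fintype.equivFin S2
  let d : Fin 3 → ℕ := ![Fintype.card S1, Fintype.card S2, 1]
  let E : (∀ i, Fin (d i)) ≃ S1 × S2 :=
    { toFun := fun y => (e1.symm (y 0), e2.symm (y 1))
      invFun := fun st i => match i with
        | 0 => e1 st.1
        | 1 => e2 st.2
        | 2 => (0 : Fin 1)
      left_inv := by
        intro y
        funext i
        match i with
        | 0 => exact e1.apply_symm_apply (y 0)
        | 1 => exact e2.apply_symm_apply (y 1)
        | 2 => exact Subsingleton.elim (α := Fin 1) _ _
      right_inv := by
        intro st
        exact Prod.ext (e1.symm_apply_apply st.1) (e2.symm_apply_apply st.2) }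
  have hE1 : ∀ y, (E y).1 = e1.symm (y 0) := fun y => rfl
  have hE2 : ∀ y, (E y).2 = e2.symm (y 1) := fun y => rfl
  refine ⟨d, fun y => r (E y), ⟨fun y => hr.1 _, ?_⟩, ?_⟩
  · rw [← hr.2]; exact E.sum_comp r
  have m0 : ∀ y, marginal (fun y => r (E y)) 0 (y 0) = ∑ t, r ((E y).1, t) := by
    intro y
    unfold marginal
    calc _ = ∑ y' : ∀ i, Fin (d i), (if (E y').1 = (E y).1 then r (E y') else 0) := by
          apply Finset.sum_congr rfl
          intro y' _
          have hiff : y' 0 = y 0 ↔ (E y').1 = (E y).1 := by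
            rw [hE1, hE1]; exact e1.symm.injective.eq_iff.symm
          exact if_congr hiff rfl rfl
      _ = ∑ st : S1 × S2, (if st.1 = (E y).1 then r st else 0) :=
          E.sum_comp (fun st => if st.1 = (E y).1 then r st else 0)
      _ = _ := by
          rw [Fintype.sum_prod_type_right]
          simp
  have m1 : ∀ y, marginal (fun y => r (E y)) 1 (y 1) = ∑ s, r (s, (E y).2) := by
    intro y
    unfold marginal
    calc _ = ∑ y' : ∀ i, Fin (d i), (if (E y').2 = (E y).2 then r (E y') else 0) := by
          apply Finset.sum_congr rfl
          intro y' _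
          have hiff : y' 1 = y 1 ↔ (E y').2 = (E y).2 := by
            rw [hE2, hE2]; exact e2.symm.injective.eq_iff.symm
          exact if_congr hiff rfl rfl
      _ = ∑ st : S1 × S2, (if st.2 = (E y).2 then r st else 0) :=
          E.sum_comp (fun st => if st.2 = (E y).2 then r st else 0)
      _ = _ := by
          rw [Fintype.sum_prod_type]
          simp
  have m2 : ∀ y : (∀ i, Fin (d i)), marginal (fun y => r (E y)) 2 (y 2) = 1 := by
    intro y
    unfold marginal
    rw [← hr.2, ← E.sum_comp r]
    apply Finset.sum_congr rfl
    intro y' _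
    rw [if_pos]
    exact Subsingleton.elim (α := Fin 1) _ _
  have hprod : ∀ y : (∀ i, Fin (d i)), ∏ i, marginal (fun y => r (E y)) i (y i) =
      (∑ t, r ((E y).1, t)) * (∑ s, r (s, (E y).2)) := by
    intro y
    rw [Fin.prod_univ_three, m0, m1, m2, mul_one]
  apply ct_majorizes
  · intro i
    unfold kron
    refine mul_nonneg (hp _) ?_
    beta_reduce
    rw [hprod]
    exact mul_nonneg (Finset.sum_nonneg fun _ _ => hr.1 _) (Finset.sum_nonneg fun _ _ => hr.1 _)
  · intro c hc
    unfold kron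
    simp only [hprod, Fintype.sum_prod_type (α₁ := Fin m)]
    have := h c hc
    calc _ = _ := Finset.sum_congr rfl fun x _ => E.sum_comp (fun st => max (q x * r st - c) 0)
      _ ≤ _ := this
      _ = _ := Finset.sum_congr rfl fun x _ => (E.sum_comp (fun st =>
          max (p x * ((∑ t, r (st.1, t)) * (∑ s, r (s, st.2))) - c) 0)).symm

lemma ct_block_sum {m W : ℕ} (n : Fin W → ℕ) (k : Bool → ℕ) (hn : ∀ i, 0 < n i)
    (hk : ∀ j, 0 < k j) (hW : 0 < W) (u : Fin m → Fin W → Bool → ℝ) (c : ℝ) :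
    ∑ x, ∑ st : (Σ i, Fin (n i)) × (Σ j, Fin (k j)),
      max (u x st.1.1 st.2.1 / (W * (n st.1.1 * k st.2.1)) - c) 0 =
    (1 / W : ℝ) * ∑ i, ∑ x, ∑ j, max (u x i j - c * W * (n i * k j)) 0 := by
  rw [Finset.sum_comm (s := Finset.univ (α := Fin W)), Finset.mul_sum]
  apply Finset.sum_congr rfl
  intro x _
  rw [Fintype.sum_prod_type]
  simp only [Fintype.sum_sigma, Finset.sum_const, Finset.card_univ, Fintype.card_fin,
    nsmul_eq_mul, Finset.mul_sum]
  apply Finset.sum_congr rfl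
  intro i _
  apply Finset.sum_congr rfl
  intro j _
  have h1 : (0:ℝ) < n i := by exact_mod_cast hn i
  have h2 : (0:ℝ) < k j := by exact_mod_cast hk j
  have h3 : (0:ℝ) < W := by exact_mod_cast hW
  rw [← mul_assoc, mul_max_of_nonneg _ _ (by positivity), mul_max_of_nonneg _ _ (by positivity)]
  congr 1
  · field_simp
  · simp

lemma ct_blocks {m : ℕ} (p q : Fin m → ℝ) (hp : IsProbDist p) (W L K : ℕ) (hW : 0 < W)
    (hK : 0 < K) (t : ℕ → ℝ) (ht0 : ∀ i, 0 ≤ t i) (ht1 : ∀ i, t i ≤ 1) (β ρ : ℝ)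
    (hρ : ρ = 1 + 1 / K) (hβ : W * β = ∑ i ∈ Finset.range W, t i)
    (h : ∀ y : ℝ, 0 ≤ y →
      ∑ i ∈ Finset.range W, ∑ x, (max ((1 - t i) * q x - y * ρ ^ i) 0 +
      max (t i * q x - y * ρ ^ (i + L)) 0) ≤
    ∑ i ∈ Finset.range W, ∑ x, (max ((1 - β) * p x - y * ρ ^ i) 0 +
      max (β * p x - y * ρ ^ (i + L)) 0)) :
    ∃ (d : Fin 3 → ℕ) (r : (∀ i, Fin (d i)) → ℝ), IsProbDist r ∧
      Majorizes (kron p (fun y : ∀ i, Fin (d i) => ∏ i, marginal r i (y i))) (kron q r) := by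
  let n : Fin W → ℕ := fun i => (K + 1) ^ (i : ℕ) * K ^ (W - i)
  let k : Bool → ℕ := fun j => if j then (K + 1) ^ L else K ^ L
  let w : Fin W → Bool → ℝ := fun i j => if j then t i else 1 - t i
  let ν : Bool → ℝ := fun j => if j then β else 1 - β
  have hn : ∀ i, 0 < n i := fun i => by simp only [n]; positivity
  have hk : ∀ j, 0 < k j := fun j => by simp only [k]; split_ifs <;> positivity
  have hn' : ∀ i, (0:ℝ) < n i := fun i => by exact_mod_cast hn i
  have hk' : ∀ i, (0:ℝ) < k i := fun i => by exact_mod_cast hk i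
  have hW' : (0:ℝ) < W := by exact_mod_cast hW
  have hK' : (0:ℝ) < K := by exact_mod_cast hK
  have hKρ : (K:ℝ) + 1 = K * ρ := by rw [hρ]; field_simp
  have hnk0 : ∀ i, (n i : ℝ) * k false = K ^ (W + L) * ρ ^ (i : ℕ) := by
    intro i
    simp only [n, k]
    push_cast
    rw [hKρ, mul_pow, show W + L = i + (W - i) + L by omega, pow_add, pow_add]
    ring
  have hnk1 : ∀ i, (n i : ℝ) * k true = K ^ (W + L) * ρ ^ ((i : ℕ) + L) := by
    intro i
    simp only [n, k]
    push_cast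
    simp only [if_true, Nat.cast_pow, Nat.cast_add, Nat.cast_one, hKρ, mul_pow]
    rw [show W + L = i + (W - i) + L by omega, pow_add, pow_add, pow_add]
    ring
  have hw0 : ∀ i j, 0 ≤ w i j := by
    intro i j
    simp only [w]
    split_ifs
    · exact ht0 _
    · linarith [ht1 i]
  have hw1 : ∀ i, ∑ j, w i j = 1 := by intro i; simp [w]
  have hwν : ∀ j, ∑ i, w i j = W * ν j := by
    intro j
    simp only [w, ν]
    cases j
    · simp [Finset.sum_sub_distrib, mul_sub, hβ, Finset.sum_range]
    · simp [hβ, Finset.sum_range]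
  let r : (Σ i, Fin (n i)) × (Σ j, Fin (k j)) → ℝ :=
    fun st => w st.1.1 st.2.1 / (W * (n st.1.1 * k st.2.1))
  have hr1 : ∀ s, ∑ t, r (s, t) = 1 / (W * n s.1) := by
    intro s
    simp only [r, Fintype.sum_sigma, Finset.sum_const, Finset.card_univ, Fintype.card_fin,
      nsmul_eq_mul]
    rw [← hw1 s.1, Finset.sum_div]
    apply Finset.sum_congr rfl
    intro j _
    have := hk' j
    have := hn' s.1
    field_simp
  have hr2 : ∀ t, ∑ s, r (s, t) = ν t.1 / k t.1 := by
    intro t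
    simp only [r, Fintype.sum_sigma, Finset.sum_const, Finset.card_univ, Fintype.card_fin,
      nsmul_eq_mul]
    have : ν t.1 / k t.1 = (W * ν t.1) / (W * k t.1) := by
      have := hk' t.1
      field_simp
    rw [this, ← hwν, Finset.sum_div]
    apply Finset.sum_congr rfl
    intro i _
    have := hk' t.1
    have := hn' i
    field_simp
  refine ct_transfer p q hp.1 r ⟨fun st => ?_, ?_⟩ ?_
  · exact div_nonneg (hw0 _ _) (by positivity)
  · rw [Fintype.sum_prod_type]
    simp only [hr1]
    simp only [Fintype.sum_sigma, Finset.sum_const, Finset.card_univ, Fintype.card_fin,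
      nsmul_eq_mul]
    have : ∀ i, (n i : ℝ) * (1 / (W * n i)) = 1 / W := by
      intro i
      have := hn' i
      field_simp
    simp only [this, Finset.sum_const, Finset.card_univ, Fintype.card_fin, nsmul_eq_mul]
    field_simp
  · intro c hc
    have e1 : ∑ x, ∑ st : (Σ i, Fin (n i)) × (Σ j, Fin (k j)), max (q x * r st - c) 0 =
        ∑ x, ∑ st : (Σ i, Fin (n i)) × (Σ j, Fin (k j)),
        max ((w st.1.1 st.2.1 * q x) / (W * (n st.1.1 * k st.2.1)) - c) 0 := by
      simp only [r]
      refine Finset.sum_congr rfl fun x _ => Finset.sum_congr rfl fun st _ => ?_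
      rw [mul_comm (w _ _), mul_div_assoc]
    have e2 : ∑ x, ∑ st : (Σ i, Fin (n i)) × (Σ j, Fin (k j)),
        max (p x * ((∑ t, r (st.1, t)) * (∑ s, r (s, st.2))) - c) 0 =
        ∑ x, ∑ st : (Σ i, Fin (n i)) × (Σ j, Fin (k j)),
        max ((ν st.2.1 * p x) / (W * (n st.1.1 * k st.2.1)) - c) 0 := by
      simp only [hr1, hr2]
      refine Finset.sum_congr rfl fun x _ => Finset.sum_congr rfl fun st _ => ?_
      have h1 := hn' st.1.1
      have h2 := hk' st.2.1
      congr 2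
      field_simp
    rw [e1, e2, ct_block_sum n k hn hk hW (fun x i j => w i j * q x),
      ct_block_sum n k hn hk hW (fun x i j => ν j * p x)]
    apply mul_le_mul_of_nonneg_left _ (by positivity)
    have := h (c * W * K ^ (W + L)) (by positivity)
    rw [Finset.sum_range, Finset.sum_range] at this
    simp only [Fintype.sum_bool, hnk0, hnk1]
    simp only [← mul_assoc]
    simp only [w, ν, if_true, Bool.false_eq_true, if_false]
    refine le_trans (le_of_eq ?_) (this.trans (le_of_eq ?_))
    · exact Finset.sum_congr rfl fun i _ => Finset.sum_congr rfl fun x _ => add_comm _ _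
    · exact Finset.sum_congr rfl fun i _ => Finset.sum_congr rfl fun x _ => add_comm _ _

lemma ctT_sum (l M : ℕ) (b : ℝ) :
    ∑ i ∈ Finset.range (2 * l + M + 2 * l), ctT l M b i = 4 * l * (1 - b) + M * b := by
  rw [Finset.sum_range_add, Finset.sum_range_add]
  have h1 : ∑ i ∈ Finset.range (2 * l), ctT l M b i = 2 * l * (1 - b) := by
    rw [Finset.sum_congr rfl (g := fun _ => 1 - b)]
    · simp; ring
    · intro i hi
      rw [Finset.mem_range] at hi
      unfold ctT; rw [if_pos (Or.inl hi)]
  have h2 : ∑ i ∈ Finset.range M, ctT l M b (2 * l + i) = M * b := by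
    rw [Finset.sum_congr rfl (g := fun _ => b)]
    · simp
    · intro i hi
      rw [Finset.mem_range] at hi
      unfold ctT; rw [if_neg (by omega)]
  have h3 : ∑ i ∈ Finset.range (2 * l), ctT l M b (2 * l + M + i) = 2 * l * (1 - b) := by
    rw [Finset.sum_congr rfl (g := fun _ => 1 - b)]
    · simp; ring
    · intro i hi
      unfold ctT; rw [if_pos (Or.inr (by omega))]
  rw [h1, h2, h3]; ring

lemma ct_exists_l (ρ A B C D F : ℝ) (hρ : 1 < ρ) : ∃ l : ℕ, 2 ≤ l ∧ A ≤ l ∧ B ≤ l ∧ C ≤ l ∧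
    D ≤ l ∧ F ≤ Real.log l ∧ (l : ℝ) ^ 6 ≤ ρ ^ (2 * l) := by
  have hc : Filter.Tendsto (fun n : ℕ => (n : ℝ)) Filter.atTop Filter.atTop :=
    tendsto_natCast_atTop_atTop
  have h6 := (tendsto_pow_const_div_const_pow_of_one_lt 6
    (show 1 < ρ ^ 2 by nlinarith)).eventually_lt_const (show (0:ℝ) < 1 by norm_num)
  obtain ⟨l, h⟩ := ((Filter.eventually_ge_atTop 2).and
    ((hc.eventually_ge_atTop A).and ((hc.eventually_ge_atTop B).and
    ((hc.eventually_ge_atTop C).and ((hc.eventually_ge_atTop D).and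
    (((Real.tendsto_log_atTop.comp hc).eventually_ge_atTop F).and h6)))))).exists
  obtain ⟨h1, h2, h3, h4, h5, h6, h7⟩ := h
  refine ⟨l, h1, h2, h3, h4, h5, h6, ?_⟩
  have : 0 < (ρ ^ 2) ^ l := by positivity
  rw [div_lt_one this] at h7
  rw [pow_mul]; exact h7.le

set_option maxHeartbeats 2000000 in
lemma ct_main {m : ℕ} (p q : Fin m → ℝ)
    (hp : IsProbDist p) (hq : IsProbDist q)
    (hq_rank : ∀ i, q i ≠ 0) (hH : shannonEntropy p < shannonEntropy q) :
    ∃ (d : Fin 3 → ℕ) (r : (∀ i, Fin (d i)) → ℝ), IsProbDist r ∧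
      Majorizes (kron p (fun y : ∀ i, Fin (d i) => ∏ i, marginal r i (y i))) (kron q r) := by
  have hm : 0 < m := by
    rcases Nat.eq_zero_or_pos m with rfl | h
    · have := hq.2; simp at this
    · exact h
  have hm' : (0:ℝ) < m := by exact_mod_cast hm
  haveI : Nonempty (Fin m) := ⟨⟨0, hm⟩⟩
  obtain ⟨x0, hx0⟩ := Finite.exists_min q
  set qm := q x0 with hqmdef
  have hqm : 0 < qm := lt_of_le_of_ne (hq.1 x0) (hq_rank x0).symm
  set g := shannonEntropy q - shannonEntropy p with hg
  have hg0 : 0 < g := by linarith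
  obtain ⟨K, hK⟩ := exists_nat_ge (max 1 (8 / g))
  have hK1 : (1:ℝ) ≤ K := (le_max_left _ _).trans hK
  have hK2 : 8 / g ≤ K := (le_max_right _ _).trans hK
  have hK0 : (0:ℝ) < K := by linarith
  have hKi : (1:ℝ) / K ≤ g / 8 := by
    rw [div_le_iff₀ hg0] at hK2
    rw [div_le_iff₀ hK0]
    linarith
  have hKi1 : (1:ℝ) / K ≤ 1 := by rw [div_le_iff₀ hK0]; linarith
  have hKpos : (0:ℝ) < 1 / K := by positivity
  set ρ : ℝ := 1 + 1 / K with hρdef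
  have hρ : 1 < ρ := by linarith
  have hρ0 : 0 < ρ := by linarith
  set h := Real.log ρ with hh
  have hh0 : 0 < h := Real.log_pos hρ
  have hh1 : h ≤ g / 8 := by
    have := Real.log_le_sub_one_of_pos hρ0
    linarith
  set a := min (g / 8) 1 with ha
  have ha0 : 0 < a := lt_min (by positivity) one_pos
  have ha1 : a ≤ 1 := min_le_right _ _
  have ha2 : a ≤ g / 8 := min_le_left _ _
  set z0 := min (1 / 2) (g / 8 / m) with hz
  have hz0 : 0 < z0 := lt_min (by norm_num) (by positivity)
  have hz1 : z0 ≤ 1 / 2 := min_le_left _ _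
  have hz2 : m * z0 ≤ g / 8 := by
    have : z0 ≤ g / 8 / m := min_le_right _ _
    rw [le_div_iff₀ hm'] at this
    linarith
  set C := m * 2 / (ρ - 1) with hC
  have hC0 : 0 ≤ C := div_nonneg (by positivity) (by linarith)
  obtain ⟨l, hl2, hA, hB, hCl, hD, hF, hpow⟩ := ct_exists_l ρ (25 + 25 * 8 / qm)
    (10 / a) (C + 1) (C * 8 / qm)
    (2 * (-Real.log z0 + h) + |shannonEntropy p| + h + 2 + h) hρ
  have hl2' : (2:ℝ) ≤ l := by exact_mod_cast hl2
  have hl0 : (0:ℝ) < l := by linarith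
  set b : ℝ := 1 / (l:ℝ) ^ 6 with hb
  have hb0 : 0 < b := by positivity
  have hl3 : (l:ℝ) ≤ (l:ℝ) ^ 3 := by nlinarith [sq_nonneg (l:ℝ), mul_self_nonneg ((l:ℝ) - 1)]
  have hl13 : (1:ℝ) ≤ (l:ℝ) ^ 3 := by linarith
  have hl6 : (l:ℝ) ≤ (l:ℝ) ^ 6 := by
    calc (l:ℝ) ≤ (l:ℝ) ^ 3 := hl3
      _ ≤ (l:ℝ) ^ 3 * (l:ℝ) ^ 3 := le_mul_of_one_le_right (by positivity) hl13
      _ = _ := by ring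
  have hb2 : b ≤ 1 / 2 := by
    rw [hb]; apply one_div_le_one_div_of_le <;> linarith
  set M := l ^ 3 with hM
  set W := 2 * l + M + 2 * l with hW
  have hWr : (W:ℝ) = 4 * l + (l:ℝ) ^ 3 := by rw [hW, hM]; push_cast; ring
  have hW0 : (0:ℝ) < W := by rw [hWr]; positivity
  set β : ℝ := (4 * l * (1 - b) + M * b) / W with hβ
  have hβ0 : 0 ≤ β := by
    have : 0 ≤ 1 - b := by linarith
    rw [hβ]; positivity
  have hβl : β ≤ 5 / (l:ℝ) ^ 2 := by
    rw [hβ, div_le_div_iff₀ hW0 (by positivity), hWr, hM]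
    push_cast
    have h1 : (l:ℝ) ^ 3 * b * (l:ℝ) ^ 2 ≤ (l:ℝ) ^ 3 := by
      have : (l:ℝ) ^ 3 * b * (l:ℝ) ^ 2 = 1 / l := by rw [hb]; field_simp
      rw [this, div_le_iff₀ hl0]
      nlinarith
    have h2 : 0 ≤ 4 * l * b * (l:ℝ) ^ 2 := by positivity
    have h3 : (4 * l * (1 - b) + (l:ℝ) ^ 3 * b) * (l:ℝ) ^ 2 =
        4 * (l:ℝ) ^ 3 - 4 * l * b * (l:ℝ) ^ 2 + (l:ℝ) ^ 3 * b * (l:ℝ) ^ 2 := by ring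
    rw [h3]
    linarith
  have hβl' : β ≤ 5 / l := hβl.trans (by
    apply div_le_div_of_nonneg_left (by norm_num) hl0; nlinarith)
  have hβa : β ≤ a / 2 := hβl'.trans (by
    rw [div_le_iff₀ ha0] at hB
    rw [div_le_iff₀ hl0]; linarith)
  set ε := 2 * (2 * l) * β + (W:ℝ) * b with hε
  have hε0 : 0 ≤ ε := by positivity
  have hεl : ε ≤ 25 / l := by
    have h1 : 2 * (2 * l) * β ≤ 20 / l := by
      calc 2 * (2 * l) * β ≤ 2 * (2 * l) * (5 / (l:ℝ) ^ 2) := by gcongr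
        _ = 20 / l := by field_simp; norm_num
    have h2 : (W:ℝ) * b ≤ 5 / l := by
      rw [hWr, hb, mul_one_div, div_le_div_iff₀ (by positivity) hl0]
      have : (l:ℝ) ^ 4 ≤ (l:ℝ) ^ 6 := pow_le_pow_right₀ (by linarith) (by norm_num)
      have : (l:ℝ) ^ 2 ≤ (l:ℝ) ^ 6 := pow_le_pow_right₀ (by linarith) (by norm_num)
      nlinarith
    calc ε ≤ 20 / l + 5 / l := add_le_add h1 h2
      _ = 25 / l := by ring
  have hq8 : 0 < 25 * 8 / qm := by positivity
  have hε1 : ε ≤ 1 := hεl.trans (by rw [div_le_iff₀ hl0]; linarith)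
  have hε2 : ε ≤ qm / 8 := hεl.trans (by
    have : 25 * 8 / qm ≤ l := by linarith
    rw [div_le_iff₀ hqm] at this
    rw [div_le_iff₀ hl0]; linarith)
  have hbρ : 1 ≤ b * ρ ^ (2 * l) := by
    rw [hb, one_div, inv_mul_eq_div, le_div_iff₀ (by positivity)]; linarith
  have hρl : (l:ℝ) ≤ ρ ^ l := by
    refine hl3.trans ?_
    apply le_of_sq_le_sq _ (by positivity)
    rw [← pow_mul, ← pow_mul, mul_comm l 2]; exact hpow
  refine ct_blocks p q hp W (2 * l) K (by positivity) (by exact_mod_cast hK0)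
    (ctT l M b) ?_ ?_ β ρ hρdef ?_ ?_
  · intro i; unfold ctT; split_ifs <;> linarith
  · intro i; unfold ctT; split_ifs <;> linarith
  · rw [hW, ctT_sum, hβ, ← hW]; field_simp
  · have hhε : h * ε ≤ h := mul_le_of_le_one_right hh0.le hε1
    apply ct_hockey p q hp hq qm hqm hx0 ρ h (1 + a) z0 b β ε l M hρ (by linarith) hh
      (by linarith) (by linarith) (by omega) hz0 (by linarith) hb0 hb2
      (by rw [ctT_sum, hβ, ← hW]; field_simp) hβ0 (by linarith) hε
    · have h1 : (1 + a) * β ≤ (1 + a) * (a / 2) := by gcongr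
      have h2 : a * a ≤ a := mul_le_of_le_one_right ha0.le ha1
      have h3 : (1 + a) * (a / 2) = a / 2 + a * a / 2 := by ring
      have h4 : (1 + a) * (1 - β) = 1 + a - (1 + a) * β := by ring
      linarith
    · have : 10 / a ≤ ρ ^ (2 * l) := hB.trans (hl6.trans hpow)
      rw [div_le_iff₀ ha0] at this
      linarith
    · exact hbρ
    · linarith
    · have : - Real.log b = 6 * Real.log l := by
        rw [hb, one_div, Real.log_inv, Real.log_pow]; push_cast; ring
      rw [this]
      have h1 : 0 ≤ Real.log l := Real.log_nonneg (by linarith)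
      have := le_abs_self (shannonEntropy p)
      linarith
    · linarith
    · have : C / ρ ^ l ≤ qm / 8 := by
        rw [div_le_iff₀ hqm] at hD
        rw [div_le_iff₀ (by positivity)]
        have := mul_le_mul_of_nonneg_left hρl hqm.le
        linarith
      linarith

/-- If `q` has full rank and `H(p) < H(q)`, then there is a tripartite
distribution `r` with marginals `r₁, r₂, r₃` such that `p ⊗ (r₁ ⊗ r₂ ⊗ r₃) ≻ q ⊗ r`. -/
theorem c_trumping_with_three_systems {m : ℕ} (p q : Fin m → ℝ)
    (hp : IsProbDist p) (hq : IsProbDist q)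
    (hq_rank : ∀ i, q i ≠ 0) (hH : shannonEntropy p < shannonEntropy q) :
    ∃ (d : Fin 3 → ℕ) (r : (∀ i, Fin (d i)) → ℝ), IsProbDist r ∧
      Majorizes (kron p (fun y : ∀ i, Fin (d i) => ∏ i, marginal r i (y i))) (kron q r) := by
  exact ct_main p q hp hq hq_rank hH
end
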